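/- arXiv:math/0507317 — 3 statements merged into one kernel-verified Lean document; each statement's English description precedes it below -/
import Mathlib

section
/- For all f,g ∈ C_c^∞(ℝⁿ×ℝⁿ), lim_{ℏ→0⁺} ‖ρ_ℏ(f) ρ_ℏ(g) − ρ_ℏ(f*g) − κ_ℏ(l(f,g))‖ = 0, where ‖·‖ is the operator norm on L²(ℝⁿ₊). -/
open MeasureTheory Filter Topology Set
open scoped ContDiff

noncomputable section

/-- `ℝ^{n−1}`, the boundary directions. -/
abbrev Eb (n : ℕ) : Type := Fin (n - 1) → ℝ

/-- `ℝⁿ` written as `ℝ^{n−1} × ℝ`; a point is `x = (x', xₙ)`. -/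
abbrev Ef (n : ℕ) : Type := Eb n × ℝ

/-- Lebesgue measure restricted to the closed half-space `ℝⁿ₊ = {x : xₙ ≥ 0}`. -/
def muPlus (n : ℕ) : Measure (Ef n) := volume.restrict {p : Ef n | 0 ≤ p.2}

/-- `L²(ℝⁿ₊)`. -/
abbrev HS (n : ℕ) := Lp ℂ 2 (muPlus n)

/-- `T` is the ℏ-scaled truncated operator `ρ_ℏ(f)` on `L²(ℝⁿ₊)`:
`(ρ_ℏ(f)ξ)(x) = ∫_{v : xₙ ≥ ℏvₙ} f(x,v) ξ(x−ℏv) dv`. -/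
def rhoSpec (n : ℕ) (ℏ : ℝ) (f : Ef n × Ef n → ℂ) (T : HS n →L[ℂ] HS n) : Prop :=
  ∀ ξ : HS n, ⇑(T ξ) =ᵐ[muPlus n]
    fun x => ∫ v in {v : Ef n | ℏ * v.2 ≤ x.2},
      f (x, v) * (ξ (x.1 - ℏ • v.1, x.2 - ℏ * v.2))

/-- `S` is the ℏ-scaled Green-type operator `κ_ℏ(K)` on `L²(ℝⁿ₊)`:
`(κ_ℏ(K)ξ)(x',xₙ) = ∫_{ℝ^{n−1}} ∫₀^∞ K(x',y',xₙ/ℏ,yₙ) ξ(x'−ℏy', ℏyₙ) dyₙ dy'`. -/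
def kappaSpec (n : ℕ) (ℏ : ℝ) (K : Eb n × Eb n × ℝ × ℝ → ℂ) (S : HS n →L[ℂ] HS n) : Prop :=
  ∀ ξ : HS n, ⇑(S ξ) =ᵐ[muPlus n]
    fun x => ∫ y' : Eb n, ∫ yn in Ioi (0:ℝ),
      K (x.1, y', x.2 / ℏ, yn) * (ξ (x.1 - ℏ • y', ℏ * yn))

/-- The measure on `ℝⁿ₊ × ℝⁿ` (base point in the half-space, tangent vector free). -/
def muT (n : ℕ) : Measure (Ef n × Ef n) := (muPlus n).prod volume

/-- `L²(ℝⁿ₊ × ℝⁿ)`. -/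
abbrev HT (n : ℕ) := Lp ℂ 2 (muT n)

/-- `P` is the fiberwise convolution operator `π₀(f)` on `L²(ℝⁿ₊×ℝⁿ)`:
`(π₀(f)ξ)(x,v) = ∫ f(x,w) ξ(x,v−w) dw`. -/
def pi0Spec (n : ℕ) (f : Ef n × Ef n → ℂ) (P : HT n →L[ℂ] HT n) : Prop :=
  ∀ ξ : HT n, ⇑(P ξ) =ᵐ[muT n] fun p => ∫ w : Ef n, f (p.1, w) * (ξ (p.1, p.2 - w))

/-- Lebesgue measure on `ℝ^{n−1} × ℝ^{n−1} × ℝ` restricted to `ℝ^{n−1} × ℝ^{n−1} × ℝ₊`. -/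
def muB (n : ℕ) : Measure (Eb n × Eb n × ℝ) :=
  volume.restrict {q : Eb n × Eb n × ℝ | 0 ≤ q.2.2}

/-- `L²(ℝ^{n−1} × ℝ^{n−1} × ℝ₊)`. -/
abbrev HB (n : ℕ) := Lp ℂ 2 (muB n)

/-- `B` is the boundary operator `π₀^∂(f⊕K)` on `L²(ℝ^{n−1}×ℝ^{n−1}×ℝ₊)`:
`(π₀^∂(f⊕K)ξ)(x',v',vₙ) = ∫_{ℝ^{n−1}} ∫₀^∞ [f(x',0,v'−w',vₙ−wₙ) + K(x',v'−w',vₙ,wₙ)]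
ξ(x',w',wₙ) dwₙ dw'`. -/
def piBSpec (n : ℕ) (f : Ef n × Ef n → ℂ) (K : Eb n × Eb n × ℝ × ℝ → ℂ)
    (B : HB n →L[ℂ] HB n) : Prop :=
  ∀ ξ : HB n, ⇑(B ξ) =ᵐ[muB n]
    fun q => ∫ w' : Eb n, ∫ wn in Ioi (0:ℝ),
      (f ((q.1, (0:ℝ)), (q.2.1 - w', q.2.2 - wn)) + K (q.1, q.2.1 - w', q.2.2, wn)) *
        (ξ (q.1, w', wn))

/-- Fiberwise convolution `(f*g)(x,w) = ∫ f(x,v) g(x,w−v) dv`. -/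
def fconv (n : ℕ) (f g : Ef n × Ef n → ℂ) : Ef n × Ef n → ℂ :=
  fun p => ∫ v : Ef n, f (p.1, v) * g (p.1, p.2 - v)

/-- The Green symbol `l(f,g)(x',y',xₙ,yₙ) =
−∫_{ℝ^{n−1}} ∫_{xₙ}^∞ f(x',0,y'−v',vₙ) g(x',0,v',xₙ−vₙ−yₙ) dvₙ dv'`. -/
def lGreen (n : ℕ) (f g : Ef n × Ef n → ℂ) : Eb n × Eb n × ℝ × ℝ → ℂ :=
  fun q => -(∫ v' : Eb n, ∫ vn in Ici q.2.2.1,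
    f ((q.1, (0:ℝ)), (q.2.1 - v', vn)) * g ((q.1, (0:ℝ)), (v', q.2.2.1 - vn - q.2.2.2)))

instance aux_inst (n : ℕ) : (volume : Measure (Ef n)).IsAddHaarMeasure :=
  Measure.prod.instIsAddHaarMeasure _ _

lemma aux_memLp (n : ℕ) (h : ℝ) (hh : 0 < h) (η : Ef n → ℂ) (hη : StronglyMeasurable η)
    (hη2 : MemLp η 2 volume) (x : Ef n) : MemLp (fun w : Ef n => η (x - h • w)) 2 volume := by
  have hm : Measurable (fun w : Ef n => x - h • w) := by fun_prop
  have hm' : AEStronglyMeasurable (fun w : Ef n => η (x - h • w)) volume :=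
    (hη.comp_measurable hm).aestronglyMeasurable
  rw [memLp_two_iff_integrable_sq_norm hm']
  rw [memLp_two_iff_integrable_sq_norm hη.aestronglyMeasurable] at hη2
  have h1 := hη2.comp_sub_left x
  exact h1.comp_smul hh.ne'

/-- integrability of localized kernels -/
lemma aux_integrable (n : ℕ) (h : ℝ) (hh : 0 < h) (η : Ef n → ℂ) (hη : StronglyMeasurable η)
    (hη2 : MemLp η 2 volume) (x : Ef n) (A C : ℝ) (Ψ : Ef n × Ef n → ℂ)
    (hΨ : StronglyMeasurable Ψ)
    (hb : ∀ p, ‖Ψ p‖ ≤ (Metric.closedBall (0 : Ef n) A).indicator (fun _ => (1:ℝ)) p.1 *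
      (Metric.closedBall (0 : Ef n) A).indicator (fun _ => C) p.2) :
    Integrable (fun p : Ef n × Ef n => Ψ p * η (x - h • p.1)) (volume.prod volume) ∧
    ‖∫ p : Ef n × Ef n, Ψ p * η (x - h • p.1) ∂(volume.prod volume)‖ ≤
      C * volume.real (Metric.closedBall (0 : Ef n) A) *
      ∫ w in Metric.closedBall (0 : Ef n) A, ‖η (x - h • w)‖ := by
  set B := Metric.closedBall (0 : Ef n) A with hB
  have hBm : MeasurableSet B := Metric.isClosed_closedBall.measurableSet
  have hBf : volume B < ⊤ := measure_closedBall_lt_top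
  have hL : IntegrableOn (fun w : Ef n => ‖η (x - h • w)‖) B := by
    have hML := aux_memLp n h hh η hη hη2 x
    have : IsFiniteMeasure (volume.restrict B) := ⟨by simpa using hBf⟩
    exact ((hML.restrict B).integrable (by norm_num)).norm
  have h1 : Integrable (B.indicator (fun w : Ef n => ‖η (x - h • w)‖)) :=
    hL.integrable_indicator hBm
  have h2 : Integrable (B.indicator (fun _ : Ef n => C)) := by
    apply IntegrableOn.integrable_indicator _ hBm
    exact integrableOn_const hBf.ne
  have h3 := h1.mul_prod h2
  have hm : Measurable (fun p : Ef n × Ef n => x - h • p.1) := by fun_prop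
  have hle : ∀ p : Ef n × Ef n, ‖Ψ p * η (x - h • p.1)‖ ≤
      B.indicator (fun w : Ef n => ‖η (x - h • w)‖) p.1 * B.indicator (fun _ : Ef n => C) p.2 := by
    intro p
    rw [norm_mul]
    refine (mul_le_mul_of_nonneg_right (hb p) (norm_nonneg _)).trans (le_of_eq ?_)
    by_cases hp : p.1 ∈ B <;> simp [hp]
    ring
  refine ⟨h3.mono' (hΨ.mul (hη.comp_measurable hm)).aestronglyMeasurable (ae_of_all _ hle), ?_⟩
  refine (norm_integral_le_of_norm_le h3 (ae_of_all _ hle)).trans (le_of_eq ?_)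
  rw [integral_prod_mul, integral_indicator hBm, integral_indicator hBm, setIntegral_const]
  simp only [smul_eq_mul]; ring

lemma aux_L2 (n : ℕ) (h : ℝ) (η : Ef n → ℂ) (hη : StronglyMeasurable η) (B : Set (Ef n)) :
    ∫⁻ x : Ef n, (∫⁻ w in B, ‖η (x - h • w)‖ₑ) ^ 2 ≤
      (volume B) ^ 2 * ∫⁻ x : Ef n, ‖η x‖ₑ ^ 2 := by
  have hm : Measurable (fun p : Ef n × Ef n => ‖η (p.1 - h • p.2)‖ₑ) := by
    have : Measurable (fun p : Ef n × Ef n => p.1 - h • p.2) := by fun_prop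
    exact (hη.comp_measurable this).enorm
  have hcs : ∀ x : Ef n, (∫⁻ w in B, ‖η (x - h • w)‖ₑ) ^ 2 ≤
      volume B * ∫⁻ w in B, ‖η (x - h • w)‖ₑ ^ 2 := by
    intro x
    have hmx : Measurable (fun w : Ef n => ‖η (x - h • w)‖ₑ) := hm.comp measurable_prodMk_left
    have := ENNReal.lintegral_mul_le_Lp_mul_Lq (volume.restrict B) Real.HolderConjugate.two_two
      (f := fun _ => 1) (g := fun w : Ef n => ‖η (x - h • w)‖ₑ) aemeasurable_const hmx.aemeasurable
    simp only [Pi.mul_apply, one_mul, ENNReal.one_rpow, lintegral_const, Measure.restrict_apply,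
      MeasurableSet.univ, univ_inter] at this
    calc _ ≤ _ := pow_le_pow_left' this 2
      _ = _ := by
        rw [mul_pow, ← ENNReal.rpow_natCast, ← ENNReal.rpow_natCast, ← ENNReal.rpow_mul,
          ← ENNReal.rpow_mul]
        norm_num
  calc _ ≤ ∫⁻ x : Ef n, volume B * ∫⁻ w in B, ‖η (x - h • w)‖ₑ ^ 2 := lintegral_mono hcs
    _ = volume B * ∫⁻ x : Ef n, ∫⁻ w in B, ‖η (x - h • w)‖ₑ ^ 2 := by
      rw [lintegral_const_mul]
      exact (hm.pow_const 2).lintegral_prod_right'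
    _ = volume B * ∫⁻ w in B, ∫⁻ x : Ef n, ‖η (x - h • w)‖ₑ ^ 2 := by
      rw [lintegral_lintegral_swap]
      exact (hm.pow_const 2).aemeasurable
    _ = _ := by
      have : ∀ w : Ef n, ∫⁻ x : Ef n, ‖η (x - h • w)‖ₑ ^ 2 = ∫⁻ x : Ef n, ‖η x‖ₑ ^ 2 := fun w =>
        lintegral_sub_right_eq_self (fun x => ‖η x‖ₑ ^ 2) (h • w)
      simp only [this, lintegral_const, Measure.restrict_apply, MeasurableSet.univ, univ_inter]
      ring

/-- The `A` term. -/
lemma aux_A (n : ℕ) (h : ℝ) (F : Ef n → ℂ) (g : Ef n × Ef n → ℂ) (η : Ef n → ℂ) (x : Ef n)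
    (hi : Integrable (fun p : Ef n × Ef n =>
      ({v : Ef n | h * v.2 ≤ x.2}.indicator F p.2 * g (x - h • p.2, p.1 - p.2))
        * η (x - h • p.1)) (volume.prod volume)) :
    ∫ v in {v : Ef n | h * v.2 ≤ x.2}, F v * ∫ u, g (x - h • v, u) * η (x - h • v - h • u)
    = ∫ p : Ef n × Ef n, ({v : Ef n | h * v.2 ≤ x.2}.indicator F p.2 *
      g (x - h • p.2, p.1 - p.2)) * η (x - h • p.1) ∂(volume.prod volume) := by
  have hms : MeasurableSet {v : Ef n | h * v.2 ≤ x.2} :=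
    measurableSet_le (by fun_prop) (by fun_prop)
  rw [integral_prod_symm _ hi, ← integral_indicator hms]
  congr 1; ext v
  simp only [mul_assoc]
  rw [integral_const_mul]
  by_cases hv : v ∈ {v : Ef n | h * v.2 ≤ x.2}
  · simp only [indicator_of_mem hv]
    congr 1
    rw [← integral_sub_right_eq_self _ v]
    congr 1; ext w
    congr 2
    rw [smul_sub]; abel
  · simp only [indicator_of_notMem hv, zero_mul]

/-- The `C` term. -/
lemma aux_C (n : ℕ) (h : ℝ) (hh : 0 < h) (f g : Ef n × Ef n → ℂ) (ξ η : Ef n → ℂ) (x : Ef n)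
    (hη : η = {p : Ef n | 0 ≤ p.2}.indicator ξ)
    (hI : ∀ w : Ef n, Integrable (fun v : Ef n => {v : Ef n | x.2 < h * v.2}.indicator
       (fun v => f ((x.1, 0), v)) v * g ((x.1, 0), w - v)))
    (hi : Integrable (fun p : Ef n × Ef n =>
      ({v : Ef n | x.2 < h * v.2}.indicator (fun v => f ((x.1, 0), v)) p.2 *
        g ((x.1, 0), p.1 - p.2)) * η (x - h • p.1)) (volume.prod volume)) :
    ∫ y' : Eb n, ∫ yn in Ioi (0:ℝ),
      lGreen n f g (x.1, y', x.2 / h, yn) * (ξ (x.1 - h • y', h * yn))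
    = - ∫ p : Ef n × Ef n, ({v : Ef n | x.2 < h * v.2}.indicator (fun v => f ((x.1, 0), v)) p.2 *
      g ((x.1, 0), p.1 - p.2)) * η (x - h • p.1) ∂(volume.prod volume) := by
  set L : Ef n → ℂ := fun w => ∫ v : Ef n, {v : Ef n | x.2 < h * v.2}.indicator
       (fun v => f ((x.1, 0), v)) v * g ((x.1, 0), w - v) with hL
  have h1 : ∀ (y' : Eb n) (yn : ℝ), lGreen n f g (x.1, y', x.2 / h, yn) =
      - L (y', x.2 / h - yn) := by
    intro y' yn
    simp only [lGreen, hL]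
    congr 1
    have := hI (y', x.2 / h - yn)
    rw [Measure.volume_eq_prod] at this
    rw [Measure.volume_eq_prod, integral_prod _ this, ← integral_sub_left_eq_self _ _ y']
    congr 1; ext v'
    rw [integral_Ici_eq_integral_Ioi, ← integral_indicator measurableSet_Ioi]
    congr 1; ext vn
    have e : (y', x.2 / h - yn) - (y' - v', vn) = (v', x.2 / h - vn - yn) := by
      ext <;> simp; ring
    by_cases hv : x.2 < h * vn
    · have hv' : x.2 / h < vn := by rw [div_lt_iff₀ hh]; linarith
      simp [indicator, hv, hv', sub_right_comm]
    · have hv' : ¬ x.2 / h < vn := by rw [div_lt_iff₀ hh]; linarith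
      simp [indicator, hv, hv']
  have h2 : Integrable (fun w : Ef n => L w * η (x - h • w)) := by
    have := hi.integral_prod_left
    simpa only [integral_mul_const, hL] using this
  rw [integral_prod _ hi]
  simp only [integral_mul_const]
  change _ = - ∫ w : Ef n, L w * η (x - h • w)
  rw [Measure.volume_eq_prod] at h2
  rw [Measure.volume_eq_prod, integral_prod _ h2, ← integral_neg]
  congr 1; ext y'
  rw [← integral_Ici_eq_integral_Ioi, ← integral_indicator measurableSet_Ici,
    ← integral_sub_left_eq_self _ _ (x.2 / h), ← integral_neg]
  congr 1; ext wn
  have e : h * (x.2 / h - wn) = x.2 - h * wn := by field_simp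
  have e2 : 0 ≤ x.2 / h - wn ↔ 0 ≤ x.2 - h * wn := by
    rw [← e]; exact (mul_nonneg_iff_of_pos_left hh).symm
  by_cases hw : 0 ≤ x.2 - h * wn
  · have hw' := e2.2 hw
    rw [indicator_of_mem (by simpa using hw'), hη, indicator_of_mem (by simpa using hw), h1, e]
    simp only [sub_sub_cancel, neg_mul]
    rfl
  · have hw' := fun h => hw (e2.1 h)
    rw [indicator_of_notMem (by simpa using hw'), hη, indicator_of_notMem (by simpa using hw)]
    simp

lemma aux_ind (n : ℕ) (z : ℂ) (M C : ℝ) (w v : Ef n)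
    (h1 : ‖v‖ ≤ M → ‖z‖ ≤ C) (h2 : z ≠ 0 → ‖v‖ ≤ M ∧ ‖w - v‖ ≤ M) (hC : 0 ≤ C) :
    ‖z‖ ≤ (Metric.closedBall (0 : Ef n) (2 * M)).indicator (fun _ => (1:ℝ)) w *
      (Metric.closedBall (0 : Ef n) (2 * M)).indicator (fun _ => C) v := by
  by_cases hz : z = 0
  · rw [hz, norm_zero]
    exact mul_nonneg (indicator_nonneg (fun _ _ => zero_le_one) _)
      (indicator_nonneg (fun _ _ => hC) _)
  · obtain ⟨hv, hw⟩ := h2 hz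
    have hM : 0 ≤ M := (norm_nonneg v).trans hv
    have hw2 : ‖w‖ ≤ 2 * M := by
      have := norm_add_le (w - v) v
      rw [sub_add_cancel] at this
      linarith
    rw [indicator_of_mem (by simpa using hw2), indicator_of_mem (by simp; linarith), one_mul]
    exact h1 hv

lemma aux_B (n : ℕ) (h : ℝ) (f g : Ef n × Ef n → ℂ) (ξ η : Ef n → ℂ) (x : Ef n)
    (hη : η = {p : Ef n | 0 ≤ p.2}.indicator ξ)
    (hi : Integrable (fun p : Ef n × Ef n =>
      (f (x, p.2) * g (x, p.1 - p.2)) * η (x - h • p.1)) (volume.prod volume)) :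
    ∫ v in {v : Ef n | h * v.2 ≤ x.2},
      fconv n f g (x, v) * (ξ (x.1 - h • v.1, x.2 - h * v.2))
    = ∫ p : Ef n × Ef n, (f (x, p.2) * g (x, p.1 - p.2)) * η (x - h • p.1)
        ∂(volume.prod volume) := by
  have hms : MeasurableSet {v : Ef n | h * v.2 ≤ x.2} :=
    measurableSet_le (by fun_prop) (by fun_prop)
  rw [integral_prod _ hi, ← integral_indicator hms]
  congr 1; ext w
  simp only [integral_mul_const]
  by_cases hw : h * w.2 ≤ x.2
  · rw [indicator_of_mem (by simpa using hw), hη, indicator_of_mem (by simpa using hw)]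
    rfl
  · rw [indicator_of_notMem (by simpa using hw), hη, indicator_of_notMem (by simpa using hw)]
    simp

lemma aux_supp (n : ℕ) (f : Ef n × Ef n → ℂ) (hf' : HasCompactSupport f) :
    ∃ M : ℝ, ∀ x v, f (x, v) ≠ 0 → ‖v‖ ≤ M := by
  obtain ⟨M, hM⟩ := hf'.isCompact.isBounded.subset_closedBall 0
  refine ⟨M, fun x v hx => ?_⟩
  have := hM (subset_tsupport f hx)
  simp only [mem_closedBall_zero_iff] at this
  exact (le_max_right _ _).trans this

lemma aux_point (n : ℕ) (f g : Ef n × Ef n → ℂ)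
    (hf : ContDiff ℝ ∞ f) (hf' : HasCompactSupport f)
    (hg : ContDiff ℝ ∞ g) (hg' : HasCompactSupport g) :
    ∃ C A : ℝ, 0 ≤ C ∧ ∀ h : ℝ, 0 < h → ∀ ξ η : Ef n → ℂ, StronglyMeasurable η →
      MemLp η 2 volume → η = {p : Ef n | 0 ≤ p.2}.indicator ξ → ∀ x : Ef n, 0 ≤ x.2 →
      ‖(∫ v in {v : Ef n | h * v.2 ≤ x.2}, f (x, v) *
          ∫ u, g (x - h • v, u) * η (x - h • v - h • u))
        - (∫ v in {v : Ef n | h * v.2 ≤ x.2},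
            fconv n f g (x, v) * (ξ (x.1 - h • v.1, x.2 - h * v.2)))
        - ∫ y' : Eb n, ∫ yn in Ioi (0:ℝ),
            lGreen n f g (x.1, y', x.2 / h, yn) * (ξ (x.1 - h • y', h * yn))‖ ≤
      (C * h) * volume.real (Metric.closedBall (0 : Ef n) A) *
        ∫ w in Metric.closedBall (0 : Ef n) A, ‖η (x - h • w)‖ := by
  obtain ⟨M1, hM1⟩ := aux_supp n f hf'
  obtain ⟨M2, hM2⟩ := aux_supp n g hg'
  obtain ⟨Cf, hCf⟩ := hf.continuous.bounded_above_of_compact_support hf'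
  obtain ⟨Cg, hCg⟩ := hg.continuous.bounded_above_of_compact_support hg'
  obtain ⟨Lf, hLf⟩ := hf.lipschitzWith_of_hasCompactSupport hf' (by simp)
  obtain ⟨Lg, hLg⟩ := hg.lipschitzWith_of_hasCompactSupport hg' (by simp)
  set M : ℝ := max 0 (max M1 M2)
  have hM0 : 0 ≤ M := le_max_left _ _
  have hfM : ∀ x v, f (x, v) ≠ 0 → ‖v‖ ≤ M := fun x v hx =>
    (hM1 x v hx).trans ((le_max_left _ _).trans (le_max_right _ _))
  have hgM : ∀ x v, g (x, v) ≠ 0 → ‖v‖ ≤ M := fun x v hx =>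
    (hM2 x v hx).trans ((le_max_right _ _).trans (le_max_right _ _))
  have hCf0 : 0 ≤ Cf := (norm_nonneg _).trans (hCf 0)
  have hCg0 : 0 ≤ Cg := (norm_nonneg _).trans (hCg 0)
  have hdf : ∀ x y v : Ef n, ‖f (x, v) - f (y, v)‖ ≤ Lf * ‖x - y‖ := by
    intro x y v
    have := hLf.norm_sub_le (x, v) (y, v)
    simpa [Prod.norm_def] using this
  have hdg : ∀ x y v : Ef n, ‖g (x, v) - g (y, v)‖ ≤ Lg * ‖x - y‖ := by
    intro x y v
    have := hLg.norm_sub_le (x, v) (y, v)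
    simpa [Prod.norm_def] using this
  have hfc := hf.continuous
  have hgc := hg.continuous
  refine ⟨(Lf * Cg + Cf * Lg) * M, 2 * M, by positivity, ?_⟩
  intro h hh ξ η hηm hη2 hη x hx
  have hs1 : MeasurableSet {v : Ef n | h * v.2 ≤ x.2} :=
    measurableSet_le (by fun_prop) (by fun_prop)
  have hs2 : MeasurableSet {v : Ef n | x.2 < h * v.2} :=
    measurableSet_lt (by fun_prop) (by fun_prop)
  set x0 : Ef n := (x.1, 0) with hx0
  set ΨA : Ef n × Ef n → ℂ := fun p => {v : Ef n | h * v.2 ≤ x.2}.indicator (fun v => f (x, v)) p.2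
    * g (x - h • p.2, p.1 - p.2) with hΨA
  set ΨB : Ef n × Ef n → ℂ := fun p => f (x, p.2) * g (x, p.1 - p.2) with hΨB
  set ΨC : Ef n × Ef n → ℂ := fun p => {v : Ef n | x.2 < h * v.2}.indicator (fun v => f (x0, v)) p.2
    * g (x0, p.1 - p.2) with hΨC
  have mA : StronglyMeasurable ΨA := by
    apply StronglyMeasurable.mul
    · exact (StronglyMeasurable.indicator (by fun_prop : Continuous fun v => f (x, v)).stronglyMeasurable
        hs1).comp_measurable measurable_snd
    · exact (by fun_prop : Continuous fun p : Ef n × Ef n =>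
        g (x - h • p.2, p.1 - p.2)).stronglyMeasurable
  have mB : StronglyMeasurable ΨB :=
    (by fun_prop : Continuous ΨB).stronglyMeasurable
  have mC : StronglyMeasurable ΨC := by
    apply StronglyMeasurable.mul
    · exact (StronglyMeasurable.indicator (by fun_prop : Continuous fun v => f (x0, v)).stronglyMeasurable
        hs2).comp_measurable measurable_snd
    · exact (by fun_prop : Continuous fun p : Ef n × Ef n =>
        g (x0, p.1 - p.2)).stronglyMeasurable
  have hnz : ∀ (s : Set (Ef n)) (y z w v : Ef n),
      s.indicator (fun v => f (y, v)) v * g (z, w - v) ≠ 0 → ‖v‖ ≤ M ∧ ‖w - v‖ ≤ M := by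
    intro s y z w v hne
    have h1 := left_ne_zero_of_mul hne
    have h2 := right_ne_zero_of_mul hne
    refine ⟨hfM y v fun h0 => h1 ?_, hgM _ _ h2⟩
    simp [indicator, h0]
  have hnz' : ∀ (y z w v : Ef n),
      f (y, v) * g (z, w - v) ≠ 0 → ‖v‖ ≤ M ∧ ‖w - v‖ ≤ M := by
    intro y z w v hne
    exact ⟨hfM y v (left_ne_zero_of_mul hne), hgM _ _ (right_ne_zero_of_mul hne)⟩
  have hbd : ∀ (s : Set (Ef n)) (y z w v : Ef n),
      ‖s.indicator (fun v => f (y, v)) v * g (z, w - v)‖ ≤ Cf * Cg := by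
    intro s y z w v
    rw [norm_mul]
    refine mul_le_mul ?_ (hCg _) (norm_nonneg _) hCf0
    exact (norm_indicator_le_norm_self _ _).trans (hCf _)
  have bA := fun p : Ef n × Ef n => aux_ind n (ΨA p) M (Cf * Cg) p.1 p.2
    (fun _ => hbd _ _ _ _ _) (hnz _ _ _ _ _) (by positivity)
  have bB := fun p : Ef n × Ef n => aux_ind n (ΨB p) M (Cf * Cg) p.1 p.2
    (fun _ => by rw [hΨB, norm_mul]; exact mul_le_mul (hCf _) (hCg _) (norm_nonneg _) hCf0)
    (hnz' _ _ _ _) (by positivity)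
  have bC := fun p : Ef n × Ef n => aux_ind n (ΨC p) M (Cf * Cg) p.1 p.2
    (fun _ => hbd _ _ _ _ _) (hnz _ _ _ _ _) (by positivity)
  have iA := (aux_integrable n h hh η hηm hη2 x _ _ ΨA mA bA).1
  have iB := (aux_integrable n h hh η hηm hη2 x _ _ ΨB mB bB).1
  have iC := (aux_integrable n h hh η hηm hη2 x _ _ ΨC mC bC).1
  have hI : ∀ w : Ef n, Integrable (fun v : Ef n => {v : Ef n | x.2 < h * v.2}.indicator
       (fun v => f (x0, v)) v * g (x0, w - v)) := by
    intro w
    have h2 : Integrable ((Metric.closedBall (0 : Ef n) (2 * M)).indicator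
        (fun _ : Ef n => Cf * Cg)) := by
      apply IntegrableOn.integrable_indicator _ Metric.isClosed_closedBall.measurableSet
      exact integrableOn_const measure_closedBall_lt_top.ne
    refine h2.mono' (mC.comp_measurable (measurable_prodMk_left (x := w))).aestronglyMeasurable
      (ae_of_all _ fun v => (bC (w, v)).trans ?_)
    refine mul_le_of_le_one_left (indicator_nonneg (fun _ _ => by positivity) _) ?_
    exact indicator_le_self' (fun _ _ => zero_le_one) _
  rw [aux_A n h (fun v => f (x, v)) g η x iA, aux_B n h f g ξ η x hη iB,
    aux_C n h hh f g ξ η x hη hI iC, sub_neg_eq_add]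
  have key := (aux_integrable n h hh η hηm hη2 x (2 * M) ((Lf * Cg + Cf * Lg) * M * h)
    (fun p => ΨA p - ΨB p + ΨC p) ((mA.sub mB).add mC) ?_).2
  · have e1 : ∫ p : Ef n × Ef n, (ΨA p - ΨB p + ΨC p) * η (x - h • p.1) ∂(volume.prod volume)
        = ∫ p : Ef n × Ef n, ΨA p * η (x - h • p.1) ∂(volume.prod volume)
        - ∫ p : Ef n × Ef n, ΨB p * η (x - h • p.1) ∂(volume.prod volume)
        + ∫ p : Ef n × Ef n, ΨC p * η (x - h • p.1) ∂(volume.prod volume) := by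
      have e2 := integral_add (iA.sub iB) iC
      have e3 := integral_sub iA iB
      simp only [Pi.sub_apply] at e2
      rw [← e3, ← e2]
      congr 1; ext p; ring
    rw [e1] at key
    exact key
  intro p
  have hLf0 : (0:ℝ) ≤ Lf := Lf.2
  have hLg0 : (0:ℝ) ≤ Lg := Lg.2
  refine aux_ind n _ M _ p.1 p.2 ?_ ?_ (by positivity)
  · intro hv
    obtain ⟨w, v⟩ := p
    simp only at hv
    simp only [hΨA, hΨB, hΨC]
    by_cases hvx : h * v.2 ≤ x.2
    · rw [indicator_of_mem (by simpa using hvx), indicator_of_notMem (by simpa using hvx), zero_mul,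
        add_zero, ← mul_sub, norm_mul]
      have h1 := hdg (x - h • v) x (w - v)
      have e : ‖x - h • v - x‖ = h * ‖v‖ := by
        rw [sub_sub_cancel_left, norm_neg, norm_smul, Real.norm_of_nonneg hh.le]
      rw [e] at h1
      calc _ ≤ Cf * (Lg * (h * ‖v‖)) := mul_le_mul (hCf _) h1 (norm_nonneg _) hCf0
        _ ≤ Cf * (Lg * (h * M)) := by gcongr
        _ ≤ _ := by
          have : 0 ≤ Lf * Cg * M * h := by positivity
          nlinarith
    · rw [indicator_of_notMem (by simpa using hvx), indicator_of_mem (by simpa using hvx), zero_mul,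
        zero_sub]
      have e : ‖x0 - x‖ ≤ h * M := by
        have e1 : ‖x0 - x‖ = x.2 := by
          simp [hx0, Prod.norm_def, abs_of_nonneg hx, hx]
        rw [e1]
        have : v.2 ≤ ‖v‖ := (le_abs_self _).trans (le_max_right _ _)
        nlinarith
      have h1 := hdg x0 x (w - v)
      have h2 := hdf x0 x v
      have e2 : -(f (x, v) * g (x, w - v)) + f (x0, v) * g (x0, w - v) =
        (f (x0, v) - f (x, v)) * g (x, w - v) + f (x0, v) * (g (x0, w - v) - g (x, w - v)) := by ring
      rw [e2]
      refine (norm_add_le _ _).trans ?_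
      rw [norm_mul, norm_mul]
      calc _ ≤ (Lf * (h * M)) * Cg + Cf * (Lg * (h * M)) := by
            refine add_le_add ?_ ?_
            · exact mul_le_mul (h2.trans (by gcongr)) (hCg _) (norm_nonneg _) (by positivity)
            · exact mul_le_mul (hCf _) (h1.trans (by gcongr)) (norm_nonneg _) hCf0
        _ = _ := by ring
  · intro hne
    by_contra hcon
    apply hne
    have a1 : ΨA p = 0 := by by_contra hc; exact hcon (hnz _ _ _ _ _ hc)
    have a2 : ΨB p = 0 := by by_contra hc; exact hcon (hnz' _ _ _ _ hc)
    have a3 : ΨC p = 0 := by by_contra hc; exact hcon (hnz _ _ _ _ _ hc)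
    simp [a1, a2, a3]

lemma aux_norm (n : ℕ) (ζ : HS n) : ‖ζ‖ₑ ^ 2 = ∫⁻ x, ‖ζ x‖ₑ ^ 2 ∂(muPlus n) := by
  rw [Lp.enorm_def, eLpNorm_eq_lintegral_rpow_enorm_toReal (by norm_num) (by norm_num),
    ← ENNReal.rpow_natCast, ← ENNReal.rpow_mul]
  norm_num

lemma aux_qmp (n : ℕ) (h : ℝ) (hh : 0 < h) (x : Ef n) (P : Ef n → Prop)
    (hP : ∀ᵐ y : Ef n, P y) : ∀ᵐ v : Ef n, P (x - h • v) := by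
  have h1 : Measure.QuasiMeasurePreserving (fun v : Ef n => h • v) volume volume := by
    refine ⟨by fun_prop, ?_⟩
    rw [Measure.map_addHaar_smul _ hh.ne']
    exact Measure.smul_absolutelyContinuous
  have h2 := (quasiMeasurePreserving_sub_left_of_right_invariant (volume : Measure (Ef n)) x)
  exact (h2.comp h1).ae hP

/-- For all `f,g ∈ C_c^∞(ℝⁿ×ℝⁿ)`,
`lim_{ℏ→0⁺} ‖ρ_ℏ(f) ρ_ℏ(g) − ρ_ℏ(f*g) − κ_ℏ(l(f,g))‖ = 0` in the operator norm
on `L²(ℝⁿ₊)`. -/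
theorem statement6 (n : ℕ) (hn : 1 ≤ n) (f g : Ef n × Ef n → ℂ)
    (hf : ContDiff ℝ ∞ f) (hf' : HasCompactSupport f)
    (hg : ContDiff ℝ ∞ g) (hg' : HasCompactSupport g)
    (T S R G : ℝ → (HS n →L[ℂ] HS n))
    (hT : ∀ ℏ ∈ Ioc (0:ℝ) 1, rhoSpec n ℏ f (T ℏ))
    (hS : ∀ ℏ ∈ Ioc (0:ℝ) 1, rhoSpec n ℏ g (S ℏ))
    (hR : ∀ ℏ ∈ Ioc (0:ℝ) 1, rhoSpec n ℏ (fconv n f g) (R ℏ))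
    (hG : ∀ ℏ ∈ Ioc (0:ℝ) 1, kappaSpec n ℏ (lGreen n f g) (G ℏ)) :
    Tendsto (fun ℏ => ‖(T ℏ).comp (S ℏ) - R ℏ - G ℏ‖) (𝓝[>] (0:ℝ)) (𝓝 0) := by
  obtain ⟨C, A, hC0, hpt⟩ := aux_point n f g hf hf' hg hg'
  set B := Metric.closedBall (0 : Ef n) A with hB
  set V := volume.real B with hV
  have hV0 : 0 ≤ V := measureReal_nonneg
  have hVe : volume B = ENNReal.ofReal V :=
    (ENNReal.ofReal_toReal measure_closedBall_lt_top.ne).symm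
  have hhalf : MeasurableSet {p : Ef n | 0 ≤ p.2} := measurableSet_le (by fun_prop) (by fun_prop)
  have main : ∀ h ∈ Ioc (0:ℝ) 1, ‖(T h).comp (S h) - R h - G h‖ ≤ C * V * V * h := by
    intro h hh1
    have hh := hh1.1
    refine ContinuousLinearMap.opNorm_le_bound _ (by positivity) fun ξ => ?_
    set η : Ef n → ℂ := {p : Ef n | 0 ≤ p.2}.indicator ξ with hη
    have hηm : StronglyMeasurable η := (Lp.stronglyMeasurable ξ).indicator hhalf
    have hη2 : MemLp η 2 volume := (memLp_indicator_iff_restrict hhalf).2 (Lp.memLp ξ)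
    have hSx : ∀ᵐ y : Ef n, 0 ≤ y.2 → (S h ξ) y = ∫ u, g (y, u) * η (y - h • u) := by
      have h1 := (ae_restrict_iff' hhalf).1 (hS h hh1 ξ)
      filter_upwards [h1] with y hy hy0
      rw [hy hy0, ← integral_indicator (measurableSet_le (by fun_prop) (by fun_prop))]
      congr 1; ext u
      by_cases hu : h * u.2 ≤ y.2
      · rw [indicator_of_mem (by simpa using hu), hη, indicator_of_mem (by simpa using hu)]
        rfl
      · rw [indicator_of_notMem (by simpa using hu), hη, indicator_of_notMem (by simpa using hu)]
        simp
    have hTS : ∀ x : Ef n, ∫ v in {v : Ef n | h * v.2 ≤ x.2},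
          f (x, v) * ((S h ξ) (x.1 - h • v.1, x.2 - h * v.2)) =
        ∫ v in {v : Ef n | h * v.2 ≤ x.2}, f (x, v) *
          ∫ u, g (x - h • v, u) * η (x - h • v - h • u) := by
      intro x
      refine setIntegral_congr_ae (measurableSet_le (by fun_prop) (by fun_prop)) ?_
      filter_upwards [aux_qmp n h hh x _ hSx] with v hv hvx
      rw [← hv (by simpa using hvx)]
      rfl
    set D := (T h).comp (S h) - R h - G h with hD
    have hDx : ∀ᵐ x ∂(muPlus n), ‖D ξ x‖ₑ ≤ ENNReal.ofReal (C * h * V) *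
        ∫⁻ w in B, ‖η (x - h • w)‖ₑ := by
      have h0 : ∀ᵐ x ∂(muPlus n), 0 ≤ x.2 := ae_restrict_mem hhalf
      have e : D ξ = T h (S h ξ) - R h ξ - G h ξ := rfl
      rw [e]
      filter_upwards [h0, hT h hh1 (S h ξ), hR h hh1 ξ, hG h hh1 ξ,
        Lp.coeFn_sub (T h (S h ξ) - R h ξ) (G h ξ), Lp.coeFn_sub (T h (S h ξ)) (R h ξ)]
        with x hx h1 h2 h3 h4 h5
      rw [h4, Pi.sub_apply, h5, Pi.sub_apply, h1, h2, h3, hTS x]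
      have hp := hpt h hh ξ η hηm hη2 hη x hx
      have hηB : IntegrableOn (fun w => η (x - h • w)) B := by
        have hML := aux_memLp n h hh η hηm hη2 x
        have : IsFiniteMeasure (volume.restrict B) := ⟨by simp [hVe]⟩
        exact (hML.restrict B).integrable (by norm_num)
      rw [← ofReal_integral_norm_eq_lintegral_enorm hηB, ← ENNReal.ofReal_mul (by positivity),
        ← ofReal_norm]
      exact ENNReal.ofReal_le_ofReal hp
    have hsq : ‖D ξ‖ₑ ^ 2 ≤ (ENNReal.ofReal (C * h * V) * ENNReal.ofReal V * ‖ξ‖ₑ) ^ 2 := by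
      rw [mul_pow, aux_norm, aux_norm]
      calc _ ≤ ∫⁻ x, (ENNReal.ofReal (C * h * V) * ∫⁻ w in B, ‖η (x - h • w)‖ₑ) ^ 2
              ∂(muPlus n) := by
            refine lintegral_mono_ae ?_
            filter_upwards [hDx] with x hx
            exact pow_le_pow_left' hx 2
        _ ≤ ∫⁻ x, (ENNReal.ofReal (C * h * V) * ∫⁻ w in B, ‖η (x - h • w)‖ₑ) ^ 2 :=
            setLIntegral_le_lintegral _ _
        _ = ENNReal.ofReal (C * h * V) ^ 2 * ∫⁻ x, (∫⁻ w in B, ‖η (x - h • w)‖ₑ) ^ 2 := by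
            simp only [mul_pow]
            exact lintegral_const_mul' _ _ (by finiteness)
        _ ≤ ENNReal.ofReal (C * h * V) ^ 2 * ((volume B) ^ 2 * ∫⁻ x : Ef n, ‖η x‖ₑ ^ 2) := by
            gcongr
            exact aux_L2 n h η hηm B
        _ = _ := by
            rw [hVe, mul_pow, ← mul_assoc]
            congr 1
            change _ = ∫⁻ x in {p : Ef n | 0 ≤ p.2}, ‖ξ x‖ₑ ^ 2
            rw [← lintegral_indicator hhalf]
            congr 1; ext x
            by_cases hx : x ∈ {p : Ef n | 0 ≤ p.2} <;> simp [hη, indicator, hx]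
    have hle := (ENNReal.pow_le_pow_left_iff two_ne_zero).1 hsq
    rw [← ofReal_norm, ← ofReal_norm, ← ENNReal.ofReal_mul (by positivity),
      ← ENNReal.ofReal_mul (by positivity), ENNReal.ofReal_le_ofReal_iff (by positivity)] at hle
    refine hle.trans (le_of_eq (by ring))
  have hlim : Tendsto (fun h : ℝ => C * V * V * h) (𝓝[>] (0:ℝ)) (𝓝 0) := by
    have : Tendsto (fun h : ℝ => C * V * V * h) (𝓝 (0:ℝ)) (𝓝 (C * V * V * 0)) :=
      (continuous_const.mul continuous_id).tendsto 0
    rw [mul_zero] at this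
    exact this.mono_left nhdsWithin_le_nhds
  refine squeeze_zero' (Eventually.of_forall fun _ => norm_nonneg _) ?_ hlim
  filter_upwards [Ioc_mem_nhdsGT (zero_lt_one' ℝ)] with h hh using main h hh
end
end

section
/- For all f,g ∈ C_c^∞(ℝⁿ×ℝⁿ), one has the exact operator identity π₀^∂(f⊕0) π₀^∂(g⊕0) = π₀^∂((f*g) ⊕ l(f,g)) on L²(ℝ^{n−1}×ℝ^{n−1}×ℝ₊). In other words, the leftover term in composing two half-space convolution operators at ℏ=0 is exactly the Green term l(f,g). -/
open MeasureTheory Filter Topology Set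
open scoped ContDiff

noncomputable section

def nuB (n : ℕ) : Measure (Ef n) := (volume : Measure (Eb n)).prod (volume.restrict (Ioi (0:ℝ)))

instance (n : ℕ) : SFinite (nuB n) := by unfold nuB; infer_instance

lemma nuB_eq (n : ℕ) : nuB n = (volume : Measure (Ef n)).restrict (univ ×ˢ Ioi (0:ℝ)) := by
  rw [nuB, Measure.volume_eq_prod, ← Measure.prod_restrict, Measure.restrict_univ]

instance (n : ℕ) : IsFiniteMeasureOnCompacts (nuB n) := by rw [nuB_eq]; infer_instance

lemma muB_eq (n : ℕ) : muB n = (volume : Measure (Eb n)).prod (nuB n) := by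
  have h1 : ({q : Eb n × Eb n × ℝ | 0 ≤ q.2.2} : Set _) = univ ×ˢ (univ ×ˢ Ici (0:ℝ)) := by
    ext q; simp
  rw [muB, h1, Measure.volume_eq_prod, ← Measure.prod_restrict, Measure.restrict_univ,
    Measure.volume_eq_prod, ← Measure.prod_restrict, Measure.restrict_univ, nuB,
    restrict_Ioi_eq_restrict_Ici]

lemma memLp_slice {n : ℕ} (ξ : HB n) :
    ∀ᵐ x : Eb n, MemLp (fun u : Ef n => ξ (x, u)) 2 (nuB n) := by
  have h : MemLp (ξ : Eb n × Ef n → ℂ) 2 ((volume : Measure (Eb n)).prod (nuB n)) := by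
    have := Lp.memLp ξ
    rwa [← muB_eq]
  have hm := h.aestronglyMeasurable.prodMk_left
  have hi := ((memLp_two_iff_integrable_sq_norm h.aestronglyMeasurable).1 h).prod_right_ae
  filter_upwards [hm, hi] with x hx1 hx2
  exact (memLp_two_iff_integrable_sq_norm hx1).2 hx2

/-- iterated integral is an integral against `nuB`. -/
lemma iter_eq {n : ℕ} {φ : Ef n → ℂ} (h : Integrable φ (nuB n)) :
    ∫ w' : Eb n, ∫ wn in Ioi (0:ℝ), φ (w', wn) = ∫ w, φ w ∂(nuB n) := by
  rw [nuB] at h ⊢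
  exact (integral_prod _ h).symm

lemma kernel_eq {n : ℕ} (F G : Ef n → ℂ) (hF : Continuous F) (hF' : HasCompactSupport F)
    (hG : Continuous G) (v u : Ef n) :
    ∫ w, F (v - w) * G (w - u) ∂(nuB n) =
      (∫ z : Ef n, F z * G (v - u - z)) +
      -(∫ v' : Eb n, ∫ vn in Ici v.2, F (v.1 - u.1 - v', vn) * G (v', v.2 - vn - u.2)) := by
  have hi : Integrable (fun w : Ef n => F (v - w) * G (w - u)) := by
    apply Continuous.integrable_of_hasCompactSupport (by fun_prop)
    apply HasCompactSupport.mul_right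
    exact hF'.comp_homeomorph (Homeomorph.subLeft v)
  have : (volume : Measure (Ef n)).IsAddLeftInvariant := by
    rw [Measure.volume_eq_prod]; infer_instance
  have : (volume : Measure (Ef n)).IsNegInvariant := by
    refine ⟨?_⟩
    rw [Measure.volume_eq_prod]
    exact ((Measure.measurePreserving_neg (volume : Measure (Eb n))).prod
      (Measure.measurePreserving_neg (volume : Measure ℝ))).map_eq
  have h1 : (∫ z : Ef n, F z * G (v - u - z)) = ∫ w : Ef n, F (v - w) * G (w - u) := by
    rw [← integral_sub_left_eq_self _ volume v]
    congr 1; ext w; congr 2; abel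
  have hs : MeasurableSet ((univ : Set (Eb n)) ×ˢ Ioi (0:ℝ)) :=
    MeasurableSet.univ.prod measurableSet_Ioi
  rw [h1, ← integral_add_compl hs hi, nuB_eq]
  have hc : ((univ : Set (Eb n)) ×ˢ Ioi (0:ℝ))ᶜ = univ ×ˢ Iic (0:ℝ) := by
    ext q; simp
  have h2 : (∫ v' : Eb n, ∫ vn in Ici v.2, F (v.1 - u.1 - v', vn) * G (v', v.2 - vn - u.2))
      = ∫ w in (univ : Set (Eb n)) ×ˢ Iic (0:ℝ), F (v - w) * G (w - u) := by
    rw [Measure.volume_eq_prod, setIntegral_prod _ (by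
      rw [← Measure.volume_eq_prod]; exact hi.integrableOn), Measure.restrict_univ,
      ← integral_sub_right_eq_self _ u.1]
    congr 1; ext w'
    rw [← integral_indicator measurableSet_Ici, ← integral_indicator measurableSet_Iic,
      ← integral_sub_left_eq_self _ volume v.2]
    congr 1; ext t
    by_cases ht : t ≤ 0
    · rw [indicator_of_mem (by simpa using ht), indicator_of_mem (by simpa using ht)]
      congr 2
      · ext1 <;> simp
      · ext1 <;> simp
    · rw [indicator_of_notMem (by simpa using ht), indicator_of_notMem (by simpa using ht)]
  rw [h2, hc]; ring

open scoped Pointwise in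
lemma key {n : ℕ} (F G : Ef n → ℂ) (hF : Continuous F) (hF' : HasCompactSupport F)
    (hG : Continuous G) (hG' : HasCompactSupport G) (h k : Ef n → ℂ)
    (hh : MemLp h 2 (nuB n)) (hk : MemLp k 2 (nuB n))
    (hkh : k =ᵐ[nuB n] fun w => ∫ u' : Eb n, ∫ un in Ioi (0:ℝ), G (w - (u', un)) * h (u', un))
    (v : Ef n) :
    ∫ w' : Eb n, ∫ wn in Ioi (0:ℝ), F (v - (w', wn)) * k (w', wn) =
    ∫ u' : Eb n, ∫ un in Ioi (0:ℝ),
      ((∫ z : Ef n, F z * G (v - (u', un) - z)) +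
      -(∫ v' : Eb n, ∫ vn in Ici v.2, F (v.1 - u' - v', vn) * G (v', v.2 - vn - un))) *
        h (u', un) := by
  have cF : HasCompactSupport (fun w => F (v - w)) := hF'.comp_homeomorph (Homeomorph.subLeft v)
  have hFv : Continuous (fun w => F (v - w)) := by fun_prop
  have hFk : Integrable (fun w => F (v - w) * k w) (nuB n) :=
    MemLp.integrable_mul (p := 2) (q := 2) (hFv.memLp_of_hasCompactSupport cF) hk
  have hGh : ∀ w, Integrable (fun u => G (w - u) * h u) (nuB n) := fun w =>
    MemLp.integrable_mul (p := 2) (q := 2) ((by fun_prop : Continuous fun u => G (w - u)).memLp_of_hasCompactSupport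
      (hG'.comp_homeomorph (Homeomorph.subLeft w))) hh
  -- joint integrability
  have hK : IsCompact ((tsupport fun w => F (v - w)) - tsupport G) := 
    sub_eq_add_neg (tsupport fun w => F (v - w)) (tsupport G) ▸
      IsCompact.add (HasCompactSupport.isCompact cF) (HasCompactSupport.isCompact hG').neg
  set K := (tsupport fun w => F (v - w)) - tsupport G with hKdef
  obtain ⟨C, hC⟩ := hG.bounded_above_of_compact_support hG'
  have hhK : Integrable (K.indicator h) (nuB n) := by
    rw [integrable_indicator_iff hK.measurableSet]
    have : Fact ((nuB n) K < ⊤) := ⟨hK.measure_lt_top⟩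
    exact (hh.restrict K).integrable (by norm_num)
  have hJ : Integrable (fun p : Ef n × Ef n => F (v - p.1) * G (p.1 - p.2) * h p.2)
      ((nuB n).prod (nuB n)) := by
    have hd : Integrable (fun p : Ef n × Ef n => (F (v - p.1) * C) * K.indicator h p.2)
        ((nuB n).prod (nuB n)) :=
      Integrable.mul_prod ((hFv.integrable_of_hasCompactSupport cF).mul_const _) hhK
    refine hd.mono ?_ (Eventually.of_forall fun p => ?_)
    · refine AEStronglyMeasurable.mul ?_ hh.aestronglyMeasurable.comp_snd
      exact (by fun_prop : Continuous fun p : Ef n × Ef n =>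
        F (v - p.1) * G (p.1 - p.2)).aestronglyMeasurable
    · by_cases h1 : F (v - p.1) = 0
      · simp [h1]
      by_cases h2 : G (p.1 - p.2) = 0
      · simp only [h2, mul_zero, zero_mul, norm_zero]; positivity
      have hm : p.2 ∈ K := by
        refine ⟨p.1, subset_tsupport _ h1, p.1 - p.2, subset_tsupport _ h2, ?_⟩
        simp
      rw [indicator_of_mem hm, norm_mul, norm_mul, norm_mul, norm_mul]
      gcongr
      exact (hC _).trans ((le_abs_self C).trans (by simp))
  have e1 : ∫ w' : Eb n, ∫ wn in Ioi (0:ℝ), F (v - (w', wn)) * k (w', wn) =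
      ∫ w, ∫ u, F (v - w) * G (w - u) * h u ∂(nuB n) ∂(nuB n) := by
    rw [iter_eq hFk]
    apply integral_congr_ae
    filter_upwards [hkh] with w hw
    rw [hw, iter_eq (hGh w), ← integral_const_mul]
    simp only [mul_assoc]
  rw [e1, integral_integral_swap hJ]
  have e2 : ∀ u, ∫ w, F (v - w) * G (w - u) * h u ∂(nuB n) =
      ((∫ z : Ef n, F z * G (v - u - z)) +
      -(∫ v' : Eb n, ∫ vn in Ici v.2, F (v.1 - u.1 - v', vn) * G (v', v.2 - vn - u.2))) *
        h u := fun u => by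
    rw [integral_mul_const, kernel_eq F G hF hF' hG]
  have hI := hJ.integral_prod_right
  simp only [e2] at hI ⊢
  exact (iter_eq hI).symm

lemma slice_cs {n : ℕ} {f : Ef n × Ef n → ℂ} (hf' : HasCompactSupport f) (a : Ef n) :
    HasCompactSupport (fun z => f (a, z)) :=
  hf'.comp_isClosedEmbedding 
    ((isometry_iff_dist_eq.2 fun x y => by simp [Prod.dist_eq]).isClosedEmbedding)

theorem statement9 (n : ℕ) (hn : 1 ≤ n) (f g : Ef n × Ef n → ℂ)
    (hf : ContDiff ℝ ∞ f) (hf' : HasCompactSupport f)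
    (hg : ContDiff ℝ ∞ g) (hg' : HasCompactSupport g)
    (Bf Bg Bfg : HB n →L[ℂ] HB n)
    (hBf : piBSpec n f (fun _ => 0) Bf)
    (hBg : piBSpec n g (fun _ => 0) Bg)
    (hBfg : piBSpec n (fconv n f g) (lGreen n f g) Bfg) :
    Bf.comp Bg = Bfg := by
  ext1 ξ
  rw [ContinuousLinearMap.comp_apply]
  apply Lp.ext
  refine (hBf (Bg ξ)).trans (EventuallyEq.trans ?_ (hBfg ξ).symm)
  have hg1 := hBg ξ
  have hae : ae (muB n) = ae ((volume : Measure (Eb n)).prod (nuB n)) := by rw [muB_eq]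
  rw [EventuallyEq, hae] at hg1 ⊢
  have hg2 := Measure.ae_ae_of_ae_prod hg1
  have hx : ∀ᵐ x : Eb n,
      (∀ᵐ y : Ef n ∂(nuB n), Bg ξ (x, y) = ∫ w' : Eb n, ∫ wn in Ioi (0:ℝ),
        g ((x, 0), (y.1 - w', y.2 - wn)) * ξ (x, w', wn)) ∧
      MemLp (fun u : Ef n => ξ (x, u)) 2 (nuB n) ∧
      MemLp (fun u : Ef n => Bg ξ (x, u)) 2 (nuB n) := by
    filter_upwards [hg2, memLp_slice ξ, memLp_slice (Bg ξ)] with x h1 h2 h3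
    refine ⟨?_, h2, h3⟩
    simpa only [add_zero] using h1
  have := Measure.quasiMeasurePreserving_fst (μ := (volume : Measure (Eb n))) (ν := nuB n) |>.ae hx
  filter_upwards [this] with q hq
  obtain ⟨h1, h2, h3⟩ := hq
  simp only [add_zero]
  exact key (fun z => f ((q.1, 0), z)) (fun z => g ((q.1, 0), z))
      (hf.continuous.comp (by fun_prop)) (slice_cs hf' _)
      (hg.continuous.comp (by fun_prop)) (slice_cs hg' _) _ _ h2 h3 h1 q.2
end
end

section
/- For every f ∈ C_c^∞(ℝⁿ×ℝⁿ) and every smooth compactly supported function K on ℝ^{n−1}×ℝ^{n−1}×ℝ₊×ℝ₊, the limit lim_{ℏ→0⁺} ‖ρ_ℏ(f) + κ_ℏ(K)‖ exists and equals max{ ‖π₀(f)‖ , ‖π₀^∂(f⊕K)‖ }, where the first norm is the operator norm on L²(ℝⁿ₊). -/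
open MeasureTheory Filter Topology Set
open scoped ContDiff

noncomputable section

set_option linter.unusedSectionVars false
set_option linter.unusedVariables false

lemma sq_le_iff {a b : ENNReal} : a ^ 2 ≤ b ^ 2 ↔ a ≤ b := by
  rw [← ENNReal.rpow_natCast, ← ENNReal.rpow_natCast, ENNReal.rpow_le_rpow_iff (by norm_num)]

lemma e2 {α : Type*} [MeasurableSpace α] (μ : Measure α) (h : α → ℂ) :
    eLpNorm h 2 μ ^ 2 = ∫⁻ x, ‖h x‖ₑ ^ 2 ∂μ := by
  have := eLpNorm_nnreal_pow_eq_lintegral (f := h) (μ := μ) (p := 2) (by norm_num)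
  simpa using this

lemma e2_le {α β : Type*} [MeasurableSpace α] [MeasurableSpace β] {μ : Measure α} {ν : Measure β}
    {h : α → ℂ} {g : β → ℂ} {c : ENNReal}
    (H : ∫⁻ x, ‖h x‖ₑ ^ 2 ∂μ ≤ c ^ 2 * ∫⁻ x, ‖g x‖ₑ ^ 2 ∂ν) :
    eLpNorm h 2 μ ≤ c * eLpNorm g 2 ν := by
  rw [← e2, ← e2, ← mul_pow] at H
  exact sq_le_iff.1 H

lemma e2_ge {α β : Type*} [MeasurableSpace α] [MeasurableSpace β] {μ : Measure α} {ν : Measure β}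
    {h : α → ℂ} {g : β → ℂ} {c : ENNReal}
    (H : eLpNorm h 2 μ ≤ c * eLpNorm g 2 ν) :
    ∫⁻ x, ‖h x‖ₑ ^ 2 ∂μ ≤ c ^ 2 * ∫⁻ x, ‖g x‖ₑ ^ 2 ∂ν := by
  rw [← e2, ← e2, ← mul_pow]
  gcongr

lemma cs {α : Type*} [MeasurableSpace α] (μ : Measure α) (G : α → ENNReal) (hG : AEMeasurable G μ) :
    (∫⁻ w, G w ∂μ) ^ 2 ≤ μ univ * ∫⁻ w, G w ^ 2 ∂μ := by
  have h := ENNReal.lintegral_mul_le_Lp_mul_Lq μ (p := 2) (q := 2)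
    (Real.holderConjugate_iff.2 ⟨by norm_num, by norm_num⟩) (f := fun _ => 1) (g := G)
    aemeasurable_const hG
  simp only [Pi.mul_apply, one_mul, ENNReal.one_rpow, lintegral_one] at h
  calc _ ≤ (μ univ ^ (1/2:ℝ) * (∫⁻ a, G a ^ (2:ℝ) ∂μ) ^ (1/2:ℝ)) ^ 2 := by gcongr
    _ = _ := by
      rw [mul_pow, ← ENNReal.rpow_natCast, ← ENNReal.rpow_natCast, ← ENNReal.rpow_mul,
        ← ENNReal.rpow_mul]
      norm_num

section gen
variable {E : Type*} [NormedAddCommGroup E] [NormedSpace ℝ E] [FiniteDimensional ℝ E]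
  [MeasureSpace E] [BorelSpace E] [SecondCountableTopology E]
  [(volume : Measure E).IsAddHaarMeasure]

lemma scal (F : E → ENNReal) (hF : Measurable F) (b : E) {s : ℝ} (hs : 0 < s) :
    ∫⁻ v, F (b + s • v) = ENNReal.ofReal ((s ^ Module.finrank ℝ E)⁻¹) * ∫⁻ x, F x := by
  have h1 : ∫⁻ x, F (b + x) = ∫⁻ x, F x := lintegral_add_left_eq_self F b
  have h2 := Measure.map_addHaar_smul (volume : Measure E) hs.ne'
  have h3 : ∫⁻ v, F (b + s • v) = ∫⁻ x, F (b + x) ∂(Measure.map (s • ·) (volume : Measure E)) := by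
    rw [lintegral_map (by fun_prop) (by fun_prop)]
  rw [h3, h2, lintegral_smul_measure, h1, abs_of_nonneg (by positivity)]
  rfl

lemma qmp (x : E) {s : ℝ} (hs : s ≠ 0) {p : E → Prop} (h : ∀ᵐ z, p z) :
    ∀ᵐ w : E, p (x - s • w) := by
  have h1 : Measure.QuasiMeasurePreserving (fun w : E => s • w) := by
    refine ⟨by fun_prop, ?_⟩
    rw [Measure.map_addHaar_smul (volume : Measure E) hs]
    exact Measure.smul_absolutelyContinuous
  have h2 := (Measure.measurePreserving_sub_left (volume : Measure E) x).quasiMeasurePreserving.comp h1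
  exact h2.ae h

lemma intg {g : E → ℂ} (hg : MemLp g 2) (x : E) {s : ℝ} (hs : s ≠ 0) (C : ℝ) :
    IntegrableOn (fun w => g (x - s • w)) (Metric.closedBall 0 C) := by
  have h0 : Integrable (indicator (Metric.closedBall x (|s| * C)) g) := by
    rw [integrable_indicator_iff Metric.isClosed_closedBall.measurableSet]
    exact (hg.locallyIntegrable (by norm_num)).integrableOn_isCompact (isCompact_closedBall _ _)
  have h1 := (h0.comp_sub_left x).comp_smul hs
  refine h1.integrableOn.congr_fun ?_ Metric.isClosed_closedBall.measurableSet
  intro w hw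
  rw [Metric.mem_closedBall, dist_zero_right] at hw
  simp only
  rw [indicator_of_mem]
  rw [Metric.mem_closedBall, dist_eq_norm]
  simp only [sub_sub_cancel_left, norm_neg, norm_smul, Real.norm_eq_abs]
  gcongr

lemma intg' {g : E → ℂ} (hg : MemLp g 2) (x : E) {s : ℝ} (hs : s ≠ 0) (C : ℝ) {k : E → ℂ}
    (hk : AEStronglyMeasurable k) {M : ℝ} (hM : ∀ w, ‖k w‖ ≤ M)
    (hC : ∀ w, C < ‖w‖ → k w = 0) :
    Integrable (fun w => k w * g (x - s • w)) := by
  have h : IntegrableOn (fun w => k w * g (x - s • w)) (Metric.closedBall 0 C) :=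
    (intg hg x hs C).bdd_mul (c := M) hk.restrict (Eventually.of_forall hM)
  refine (integrableOn_iff_integrable_of_support_subset ?_).1 h
  intro w hw
  by_contra hh
  apply hw
  simp only [Metric.mem_closedBall, dist_zero_right, not_le] at hh
  simp [hC w hh]

lemma young {X : Type*} [MeasurableSpace X] {ρ : Measure X} [SFinite ρ] (C : ℝ) (h : X → E → ℂ)
    (G : X × E → ENNReal) (hG : Measurable G)
    (hh : ∀ p w, ‖h p w‖ₑ ≤ (Metric.closedBall (0:E) C).indicator (fun w => G (p, w)) w) :
    ∫⁻ p, ‖∫ w, h p w‖ₑ ^ 2 ∂ρ ≤ volume (Metric.closedBall (0:E) C) *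
      ∫⁻ w in Metric.closedBall (0:E) C, ∫⁻ p, G (p, w) ^ 2 ∂ρ := by
  have hm : MeasurableSet (Metric.closedBall (0:E) C) := Metric.isClosed_closedBall.measurableSet
  calc _ ≤ ∫⁻ p, volume (Metric.closedBall (0:E) C) *
      (∫⁻ w in Metric.closedBall (0:E) C, G (p, w) ^ 2) ∂ρ := by
        gcongr with p
        calc _ ≤ (∫⁻ w, ‖h p w‖ₑ) ^ 2 := by
              gcongr; exact enorm_integral_le_lintegral_enorm _
          _ ≤ (∫⁻ w, (Metric.closedBall (0:E) C).indicator (fun w => G (p, w)) w) ^ 2 := by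
              gcongr with w; exact hh p w
          _ ≤ _ := by
              rw [lintegral_indicator hm]
              refine (cs _ _ (by fun_prop)).trans_eq ?_
              simp
    _ = _ := by
        rw [lintegral_const_mul _ (by fun_prop), lintegral_lintegral_swap]
        exact Measurable.aemeasurable (by simpa [Function.uncurry_def] using hG.pow_const 2)
end gen

lemma enorm_re (r : ℝ) : ‖(r : ℂ)‖ₑ = ‖r‖ₑ := by
  rw [← ofReal_norm, ← ofReal_norm, Complex.norm_real]

lemma sq_add_le (a b : ENNReal) : (a + b) ^ 2 ≤ 2 * a ^ 2 + 2 * b ^ 2 := by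
  induction a with
  | top => simp
  | coe a =>
    induction b with
    | top => simp
    | coe b =>
      norm_cast
      rw [← NNReal.coe_le_coe]
      push_cast
      nlinarith [sq_nonneg ((a:ℝ) - b)]

section gen2
variable {E : Type*} [NormedAddCommGroup E] [NormedSpace ℝ E] [FiniteDimensional ℝ E]
  [MeasureSpace E] [BorelSpace E] [SecondCountableTopology E]
  [(volume : Measure E).IsAddHaarMeasure]
variable {Y : Type*} [MeasurableSpace Y]

def Op (k : E → E → ℂ) (s : ℝ) (ξ : E → ℂ) (x : E) : ℂ := ∫ w, k x w * ξ (x - s • w)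

def FOp (q : Y → E → E → ℂ) (ξ : Y × E → ℂ) (p : Y × E) : ℂ :=
  ∫ w, q p.1 p.2 w * ξ (p.1, p.2 - w)

def OpBound (k : E → E → ℂ) (s : ℝ) (c : ENNReal) : Prop :=
  ∀ ξ : E → ℂ, Measurable ξ → MemLp ξ 2 → eLpNorm (Op k s ξ) 2 ≤ c * eLpNorm ξ 2

def FBound (ν : Measure Y) (q : Y → E → E → ℂ) (c : ENNReal) : Prop :=
  ∀ ξ : Y × E → ℂ, Measurable ξ → MemLp ξ 2 (ν.prod volume) →
    eLpNorm (FOp q ξ) 2 (ν.prod volume) ≤ c * eLpNorm ξ 2 (ν.prod volume)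

/-- regularity of a kernel on `X` -/
structure KReg {X : Type*} [MeasurableSpace X] (k : X → E → ℂ) (M C : ℝ) : Prop where
  meas : Measurable (fun p : X × E => k p.1 p.2)
  bdd : ∀ x w, ‖k x w‖ ≤ M
  supp : ∀ x w, C < ‖w‖ → k x w = 0

lemma KReg.aesm {X : Type*} [MeasurableSpace X] {k : X → E → ℂ} {M C : ℝ} (h : KReg k M C) (x : X) :
    AEStronglyMeasurable (k x) :=
  (h.meas.comp (measurable_const.prodMk measurable_id)).aestronglyMeasurable

lemma meas_int {X : Type*} [MeasurableSpace X] {F : X → E → ℂ}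
    (hF : Measurable (fun p : X × E => F p.1 p.2)) : Measurable (fun x => ∫ w, F x w) :=
  (hF.stronglyMeasurable.integral_prod_right).measurable

lemma Op_meas {k : E → E → ℂ} {M C s : ℝ} (hk : KReg k M C) {ξ : E → ℂ} (hξ : Measurable ξ) :
    Measurable (Op k s ξ) := by
  apply meas_int
  have := hk.meas
  fun_prop

lemma FOp_meas {q : Y → E → E → ℂ} {M C : ℝ} (hk : KReg (fun p : Y × E => q p.1 p.2) M C)
    {ξ : Y × E → ℂ} (hξ : Measurable ξ) :
    Measurable (FOp q ξ) := by
  have h1 := hk.meas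
  have h2 : Measurable (fun p : (Y × E) × E => ξ (p.1.1, p.1.2 - p.2)) := by fun_prop
  exact meas_int (h1.mul h2)

lemma shift {ν : Measure Y} [SFinite ν] (g : Y × E → ENNReal) (hg : Measurable g) (w : E) :
    ∫⁻ p, g (p.1, p.2 - w) ∂(ν.prod (volume : Measure E)) = ∫⁻ p, g p ∂(ν.prod volume) := by
  rw [lintegral_prod _ (by fun_prop), lintegral_prod _ (by fun_prop)]
  congr 1; ext y
  exact lintegral_sub_right_eq_self (fun v => g (y, v)) w

lemma ae_memLp {ν : Measure Y} [SFinite ν] {ξ : Y × E → ℂ} (hm : Measurable ξ)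
    (hξ : MemLp ξ 2 (ν.prod (volume : Measure E))) : ∀ᵐ y ∂ν, MemLp (fun v => ξ (y, v)) 2 := by
  have h1 : ∫⁻ p, ‖ξ p‖ₑ ^ 2 ∂(ν.prod (volume : Measure E)) ≠ ⊤ := by
    rw [← e2]; exact ENNReal.pow_ne_top hξ.2.ne
  rw [lintegral_prod _ (by fun_prop)] at h1
  have h2 := ae_lt_top' (by fun_prop) h1
  filter_upwards [h2] with y hy
  refine ⟨(by fun_prop : Measurable fun v => ξ (y, v)).aestronglyMeasurable, ?_⟩
  rw [← e2] at hy
  by_contra h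
  simp only [not_lt, top_le_iff] at h
  simp [h] at hy

theorem lower {ν : Measure Y} [SFinite ν] {k : E → E → ℂ} {M C s ε : ℝ} (hs : 0 < s)
    (hk : KReg k M C) {q : Y → E → E → ℂ} (hq : KReg (fun p : Y × E => q p.1 p.2) M C)
    {β : Y → E} (hβ : Measurable β) {c : ENNReal} (hc : OpBound k s c)
    {ξ : Y × E → ℂ} (hm : Measurable ξ) (hξ : MemLp ξ 2 (ν.prod (volume : Measure E)))
    (hcl : ∀ y v w, ‖w‖ ≤ C → ξ (y, v - w) ≠ 0 → ‖k (β y + s • v) w - q y v w‖ ≤ ε) :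
    eLpNorm (FOp q ξ) 2 (ν.prod volume) ≤
      (c + volume (Metric.closedBall (0:E) C) * ENNReal.ofReal ε) *
        eLpNorm ξ 2 (ν.prod volume) := by
  have hkm := hk.meas
  have hqm := hq.meas
  have hkm' : Measurable (fun p : (Y × E) × E => k (β p.1.1 + s • p.1.2) p.2) :=
    hkm.comp (((hβ.comp (measurable_fst.fst)).add (measurable_fst.snd.const_smul s)).prodMk
      measurable_snd)
  have hxm' : Measurable (fun p : (Y × E) × E => ξ (p.1.1, p.1.2 - p.2)) := by fun_prop
  set F1 : Y × E → ℂ := fun p => ∫ w, k (β p.1 + s • p.2) w * ξ (p.1, p.2 - w) with hF1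
  set F2 : Y × E → ℂ := fun p => ∫ w, (q p.1 p.2 w - k (β p.1 + s • p.2) w) * ξ (p.1, p.2 - w)
    with hF2
  have mF1 : Measurable F1 := meas_int (hkm'.mul hxm')
  have mF2 : Measurable F2 := meas_int ((hqm.sub hkm').mul hxm')
  have hae := ae_memLp hm hξ
  have hsum : FOp q ξ =ᵐ[ν.prod volume] F1 + F2 := by
    have := Measure.quasiMeasurePreserving_fst (μ := ν) (ν := (volume : Measure E)) |>.ae hae
    filter_upwards [this] with p hp
    have i1 := intg' hp p.2 one_ne_zero C (hq.aesm p) (hq.bdd p) (hq.supp p)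
    have i2 := intg' hp p.2 one_ne_zero C (hk.aesm (β p.1 + s • p.2)) (hk.bdd _) (hk.supp _)
    simp only [one_smul] at i1 i2
    simp only [FOp, hF1, hF2, Pi.add_apply]
    simp only [sub_mul]
    rw [integral_sub i1 i2]
    ring
  rw [eLpNorm_congr_ae hsum, add_mul]
  refine (eLpNorm_add_le mF1.aestronglyMeasurable mF2.aestronglyMeasurable (by norm_num)).trans ?_
  gcongr
  · apply e2_le
    rw [lintegral_prod _ (by fun_prop), lintegral_prod _ (by fun_prop),
      ← lintegral_const_mul _ (by fun_prop)]
    refine lintegral_mono_ae ?_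
    filter_upwards [hae] with y hy
    set g : E → ℂ := fun x => ξ (y, s⁻¹ • (x - β y)) with hg
    have hgm : Measurable g := by fun_prop
    have hgs : ∀ v, g (β y + s • v) = ξ (y, v) := by
      intro v; simp [hg, smul_smul, hs.ne']
    have hF : ∀ v, F1 (y, v) = Op k s g (β y + s • v) := by
      intro v
      simp only [hF1, Op]
      congr 1; ext w
      rw [show β y + s • v - s • w = β y + s • (v - w) by rw [smul_sub]; abel, hgs]
    have e1 : ∫⁻ v, ‖ξ (y, v)‖ₑ ^ 2 =
        ENNReal.ofReal ((s ^ Module.finrank ℝ E)⁻¹) * ∫⁻ x, ‖g x‖ₑ ^ 2 := by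
      rw [← scal (fun x => ‖g x‖ₑ ^ 2) (by fun_prop) (β y) hs]
      simp only [hgs]
    have e3 : ∫⁻ v, ‖F1 (y, v)‖ₑ ^ 2 =
        ENNReal.ofReal ((s ^ Module.finrank ℝ E)⁻¹) * ∫⁻ x, ‖Op k s g x‖ₑ ^ 2 := by
      have := Op_meas (s := s) hk hgm
      rw [← scal (fun x => ‖Op k s g x‖ₑ ^ 2) (by fun_prop) (β y) hs]
      simp only [hF]
    have hJ : ENNReal.ofReal ((s ^ Module.finrank ℝ E)⁻¹) ≠ 0 := by
      simp only [ne_eq, ENNReal.ofReal_eq_zero, not_le]; positivity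
    have hgL : MemLp g 2 := by
      refine ⟨hgm.aestronglyMeasurable, ?_⟩
      have h1 : ∫⁻ v, ‖ξ (y, v)‖ₑ ^ 2 ≠ ⊤ := by
        rw [← e2 _ (fun v => ξ (y, v))]; exact ENNReal.pow_ne_top hy.2.ne
      rw [e1] at h1
      by_contra h
      simp only [not_lt, top_le_iff] at h
      rw [← e2, h] at h1
      simp [ENNReal.mul_top hJ] at h1
    have := e2_ge (hc g hgm hgL)
    rw [e1, e3]
    calc _ ≤ ENNReal.ofReal ((s ^ Module.finrank ℝ E)⁻¹) * (c ^ 2 * ∫⁻ x, ‖g x‖ₑ ^ 2) := by gcongr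
      _ = _ := by ring
  · apply e2_le
    refine (young C _ (fun p => ENNReal.ofReal ε * ‖ξ (p.1.1, p.1.2 - p.2)‖ₑ) (by fun_prop)
      ?_).trans ?_
    · intro p w
      by_cases hw : ‖w‖ ≤ C
      · rw [indicator_of_mem (by simpa using hw)]
        by_cases h0 : ξ (p.1, p.2 - w) = 0
        · simp [h0]
        · rw [enorm_mul]
          gcongr
          rw [← ofReal_norm, norm_sub_rev]
          exact ENNReal.ofReal_le_ofReal (hcl _ _ _ hw h0)
      · rw [hq.supp p w (not_le.1 hw), hk.supp _ w (not_le.1 hw)]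
        simp
    · simp only [mul_pow]
      calc _ = volume (Metric.closedBall (0:E) C) * ∫⁻ w in Metric.closedBall (0:E) C,
            (ENNReal.ofReal ε ^ 2 * ∫⁻ p, ‖ξ p‖ₑ ^ 2 ∂(ν.prod volume)) := by
            congr 1
            refine lintegral_congr fun w => ?_
            rw [lintegral_const_mul _ (by fun_prop),
              shift (fun p => ‖ξ p‖ₑ ^ 2) (by fun_prop) w]
        _ ≤ _ := by
            rw [lintegral_const]
            simp only [MeasurableSet.univ, Measure.restrict_apply, univ_inter]
            apply le_of_eq; ring

theorem upper {ν : Measure Y} [SFinite ν] {k : E → E → ℂ} {M C s ε : ℝ} (hs : 0 < s)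
    (hk : KReg k M C) {q : Y → E → E → ℂ} (hq : KReg (fun p : Y × E => q p.1 p.2) M C)
    {β : Y → E} (hβ : Measurable β) {c : ENNReal} (hc : FBound ν q c)
    {Φ : Y × E → ℝ} (hΦ : Measurable Φ) {A : ℝ} (hΦA : ∀ p, ‖Φ p‖ ≤ A) {χ : E → ℝ} (hχ : Measurable χ) (hχ1 : ∀ x, |χ x| ≤ 1)
    {j δ e : ENNReal} (hj0 : j ≠ 0) (hj1 : j ≠ ⊤)
    (H1 : ∀ g : E → ENNReal, Measurable g →
      ∫⁻ p, ‖Φ p‖ₑ ^ 2 * g (β p.1 + s • p.2) ∂(ν.prod volume) = j ^ 2 * ∫⁻ x, ‖χ x‖ₑ ^ 2 * g x)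
    (H2 : ∀ w, ‖w‖ ≤ C → ∀ g : E → ENNReal, Measurable g →
      ∫⁻ p, ‖Φ (p.1, p.2 + w) - Φ p‖ₑ ^ 2 * g (β p.1 + s • p.2) ∂(ν.prod volume)
        ≤ j ^ 2 * (δ * ∫⁻ x, g x))
    (hcl : ∀ y u w, ‖w‖ ≤ C → Φ (y, u) ≠ 0 →
      ‖k (β y + s • (u + w)) w - q y (u + w) w‖ ≤ ε)
    (he : volume (Metric.closedBall (0:E) C) ^ 2 *
      (2 * ENNReal.ofReal ε ^ 2 + 2 * ENNReal.ofReal M ^ 2 * δ) ≤ e ^ 2)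
    {ξ : E → ℂ} (hm : Measurable ξ) (hξ : MemLp ξ 2) :
    eLpNorm (fun x => (χ x : ℂ) * Op k s ξ x) 2 ≤
      c * eLpNorm (fun x => (χ x : ℂ) * ξ x) 2 + e * eLpNorm ξ 2 := by
  have hkm := hk.meas
  have hqm := hq.meas
  set τ : Y × E → E := fun p => β p.1 + s • p.2 with hτ
  have hτm : Measurable τ := by fun_prop
  have hOm := Op_meas (s := s) hk hm
  have key : ∀ g : E → ℂ, Measurable g →
      eLpNorm (fun p => (Φ p : ℂ) * g (τ p)) 2 (ν.prod volume) =
      j * eLpNorm (fun x => (χ x : ℂ) * g x) 2 := by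
    intro g hg
    have h := H1 (fun x => ‖g x‖ₑ ^ 2) (by fun_prop)
    have h' : ∫⁻ p, ‖(Φ p : ℂ) * g (τ p)‖ₑ ^ 2 ∂(ν.prod volume)
        = j ^ 2 * ∫⁻ x, ‖(χ x : ℂ) * g x‖ₑ ^ 2 := by
      simp only [enorm_mul, mul_pow, enorm_re] 
      exact h
    rw [← e2, ← e2, ← mul_pow] at h'
    exact le_antisymm (sq_le_iff.1 h'.le) (sq_le_iff.1 h'.ge)
  set Ξ : Y × E → ℂ := fun p => (Φ p : ℂ) * ξ (τ p) with hΞ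
  have hΞm : Measurable Ξ := by fun_prop
  have hle : eLpNorm (fun x => (χ x : ℂ) * ξ x) 2 ≤ eLpNorm ξ 2 := by
    refine eLpNorm_mono fun x => ?_
    rw [norm_mul]
    have : ‖(χ x : ℂ)‖ ≤ 1 := by simpa using hχ1 x
    exact mul_le_of_le_one_left (norm_nonneg _) this
  have hΞL : MemLp Ξ 2 (ν.prod volume) := by
    refine ⟨hΞm.aestronglyMeasurable, ?_⟩
    rw [hΞ, key ξ hm]
    exact ENNReal.mul_lt_top hj1.lt_top (hle.trans_lt hξ.2)
  have hQ := hc Ξ hΞm hΞL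
  have hFm := FOp_meas hq hΞm
  set D : Y × E → ℂ := fun p => (Φ p : ℂ) * Op k s ξ (τ p) - FOp q Ξ p with hD
  have hDm : Measurable D := by fun_prop
  have hDi : ∀ p, D p = ∫ w, (k (τ p) w * (Φ p : ℂ) - q p.1 p.2 w * (Φ (p.1, p.2 - w) : ℂ)) *
      ξ (τ (p.1, p.2 - w)) := by
    intro p
    have ht : ∀ w, τ (p.1, p.2 - w) = τ p - s • w := by
      intro w; simp only [hτ, smul_sub]; abel
    have i1 := (intg' hξ (τ p) hs.ne' C (hk.aesm (τ p)) (hk.bdd _) (hk.supp _)).const_mul (Φ p : ℂ)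
    have i0 : Integrable (fun w => q p.1 p.2 w * Ξ (p.1, p.2 - w)) := by
      have h := intg' hξ (τ p) hs.ne' C (k := fun w => q p.1 p.2 w * (Φ (p.1, p.2 - w) : ℂ))
        (M := M * A) ((hq.aesm p).mul (by fun_prop : Measurable fun w =>
          (Φ (p.1, p.2 - w) : ℂ)).aestronglyMeasurable) ?_ ?_
      · refine h.congr (Eventually.of_forall fun w => ?_)
        simp only [hΞ, ht]; ring
      · intro w
        rw [norm_mul, Complex.norm_real]
        exact mul_le_mul (hq.bdd p w) (hΦA _) (norm_nonneg _) ((norm_nonneg _).trans (hq.bdd p w))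
      · intro w hw
        rw [hq.supp p w hw, zero_mul]
    simp only [hD, Op, FOp]
    rw [← integral_const_mul, ← integral_sub i1 i0]
    congr 1; ext w
    simp only [hΞ, ht]; ring
  have hDn : eLpNorm D 2 (ν.prod volume) ≤ (e * j) * eLpNorm ξ 2 := by
    apply e2_le
    set G0 : (Y × E) × E → ENNReal := fun a => (ENNReal.ofReal ε * ‖Φ a.1‖ₑ +
      ENNReal.ofReal M * ‖Φ (a.1.1, a.1.2 + a.2) - Φ a.1‖ₑ) * ‖ξ (τ a.1)‖ₑ with hG0
    have hG0m : Measurable G0 := by fun_prop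
    simp only [hDi]
    refine (young C _ (fun a => G0 ((a.1.1, a.1.2 - a.2), a.2)) (by fun_prop) ?_).trans ?_
    · intro p w
      by_cases hw : ‖w‖ ≤ C
      · rw [indicator_of_mem (by simpa using hw)]
        rw [enorm_mul, hG0]
        simp only [sub_add_cancel]
        gcongr
        have hsp : k (τ p) w * (Φ p : ℂ) - q p.1 p.2 w * (Φ (p.1, p.2 - w) : ℂ) =
          (k (τ p) w - q p.1 p.2 w) * (Φ (p.1, p.2 - w) : ℂ) +
            k (τ p) w * ((Φ p - Φ (p.1, p.2 - w) : ℝ) : ℂ) := by push_cast; ring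
        rw [hsp]
        refine (enorm_add_le _ _).trans ?_
        simp only [enorm_mul, enorm_re]
        refine add_le_add ?_ (mul_le_mul_left ?_ _)
        · by_cases h0 : Φ (p.1, p.2 - w) = 0
          · simp [h0]
          · gcongr
            rw [← ofReal_norm]
            have := hcl _ _ _ hw h0
            simp only [sub_add_cancel] at this
            exact ENNReal.ofReal_le_ofReal this
        · rw [← ofReal_norm]
          exact ENNReal.ofReal_le_ofReal (hk.bdd _ _)
      · rw [hq.supp p w (not_le.1 hw), hk.supp _ w (not_le.1 hw)]
        simp
    · have hb : ∀ w, ‖w‖ ≤ C → ∫⁻ p, G0 ((p.1, p.2 - w), w) ^ 2 ∂(ν.prod volume) ≤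
          (j ^ 2 * ((2 * ENNReal.ofReal ε ^ 2 + 2 * ENNReal.ofReal M ^ 2 * δ) *
            ∫⁻ x, ‖ξ x‖ₑ ^ 2)) := by
        intro w hw
        rw [shift (fun p => G0 (p, w) ^ 2) (by fun_prop) w]
        calc _ ≤ ∫⁻ p, (2 * ENNReal.ofReal ε ^ 2 * (‖Φ p‖ₑ ^ 2 * ‖ξ (τ p)‖ₑ ^ 2) +
              2 * ENNReal.ofReal M ^ 2 * (‖Φ (p.1, p.2 + w) - Φ p‖ₑ ^ 2 * ‖ξ (τ p)‖ₑ ^ 2))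
                ∂(ν.prod volume) := by
              gcongr with p
              simp only [hG0]
              rw [mul_pow]
              refine (mul_le_mul_left (sq_add_le _ _) _).trans_eq ?_
              ring
          _ ≤ 2 * ENNReal.ofReal ε ^ 2 * (j ^ 2 * ∫⁻ x, ‖ξ x‖ₑ ^ 2) +
              2 * ENNReal.ofReal M ^ 2 * (j ^ 2 * (δ * ∫⁻ x, ‖ξ x‖ₑ ^ 2)) := by
              rw [lintegral_add_left (by fun_prop), lintegral_const_mul _ (by fun_prop),
                lintegral_const_mul _ (by fun_prop)]
              gcongr
              · rw [H1 (fun x => ‖ξ x‖ₑ ^ 2) (by fun_prop)]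
                gcongr with x
                have : ‖χ x‖ₑ ≤ 1 := by
                  rw [← ofReal_norm]; simpa using hχ1 x
                calc _ ≤ 1 ^ 2 * ‖ξ x‖ₑ ^ 2 := by gcongr
                  _ = _ := by simp
              · exact H2 w hw (fun x => ‖ξ x‖ₑ ^ 2) (by fun_prop)
          _ = _ := by ring
      calc _ ≤ volume (Metric.closedBall (0:E) C) * ∫⁻ w in Metric.closedBall (0:E) C,
            (j ^ 2 * ((2 * ENNReal.ofReal ε ^ 2 + 2 * ENNReal.ofReal M ^ 2 * δ) *
            ∫⁻ x, ‖ξ x‖ₑ ^ 2)) := by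
            gcongr 1
            refine setLIntegral_mono' Metric.isClosed_closedBall.measurableSet fun w hw => ?_
            exact hb w (by simpa using hw)
        _ = volume (Metric.closedBall (0:E) C) ^ 2 *
            (2 * ENNReal.ofReal ε ^ 2 + 2 * ENNReal.ofReal M ^ 2 * δ) *
             (j ^ 2 * ∫⁻ x, ‖ξ x‖ₑ ^ 2) := by
            rw [lintegral_const]
            simp only [MeasurableSet.univ, Measure.restrict_apply, univ_inter]
            ring
        _ ≤ e ^ 2 * (j ^ 2 * ∫⁻ x, ‖ξ x‖ₑ ^ 2) := by gcongr
        _ = _ := by ring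
  have hfin : j * eLpNorm (fun x => (χ x : ℂ) * Op k s ξ x) 2 ≤
      j * (c * eLpNorm (fun x => (χ x : ℂ) * ξ x) 2 + e * eLpNorm ξ 2) := by
    rw [← key _ hOm]
    have : (fun p => (Φ p : ℂ) * Op k s ξ (τ p)) = FOp q Ξ + D := by
      ext p; simp [hD]
    rw [this]
    refine (eLpNorm_add_le hFm.aestronglyMeasurable hDm.aestronglyMeasurable (by norm_num)).trans ?_
    refine (add_le_add hQ hDn).trans_eq ?_
    rw [hΞ, key _ hm]; ring
  exact (ENNReal.mul_le_mul_iff_right hj0 hj1).1 hfin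
end gen2

lemma dense_bound {X : Type*} [MeasurableSpace X] {μ : Measure X}
    {D : Lp ℂ 2 μ →L[ℂ] Lp ℂ 2 μ} {c : ℝ} (hc : 0 ≤ c) (S : ℕ → Set X)
    (hS : ∀ k, MeasurableSet (S k)) (hSx : ∀ᵐ x ∂μ, ∀ᶠ k in atTop, x ∈ S k)
    (h : ∀ k, ∀ ξ : X → ℂ, Measurable ξ → ∀ hL : MemLp ξ 2 μ, (∀ x, x ∉ S k → ξ x = 0) →
      ‖D (hL.toLp ξ)‖ ≤ c * ‖hL.toLp ξ‖) : ‖D‖ ≤ c := by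
  refine D.opNorm_le_bound hc fun η => ?_
  have hηm : Measurable η := (Lp.stronglyMeasurable η).measurable
  have hηL : MemLp η 2 μ := Lp.memLp η
  have hL : ∀ k, MemLp ((S k).indicator η) 2 μ := fun k => hηL.indicator (hS k)
  have ht : Tendsto (fun k => (hL k).toLp _) atTop (𝓝 η) := by
    suffices hh : Tendsto (fun k => (hL k).toLp _) atTop (𝓝 (hηL.toLp η)) by
      rwa [Lp.toLp_coeFn η hηL] at hh
    rw [Lp.tendsto_Lp_iff_tendsto_eLpNorm'']
    have hsq : Tendsto (fun k => eLpNorm ((S k).indicator η - (η : X → ℂ)) 2 μ ^ 2) atTop (𝓝 0) := by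
      simp only [e2]
      have h0 : (0 : ENNReal) = ∫⁻ x, 0 ∂μ := by simp
      rw [h0]
      refine tendsto_lintegral_of_dominated_convergence (fun x => ‖η x‖ₑ ^ 2) ?_ ?_ ?_ ?_
      · intro k
        have := hηm.indicator (hS k)
        exact ((this.sub hηm).enorm.pow_const 2)
      · intro k
        refine Eventually.of_forall fun x => ?_
        by_cases hx : x ∈ S k <;> simp [hx]
      · rw [← e2]; exact ENNReal.pow_ne_top hηL.2.ne
      · filter_upwards [hSx] with x hx
        refine tendsto_const_nhds.congr' ?_
        filter_upwards [hx] with k hk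
        simp [hk]
    have h3 := (ENNReal.continuous_rpow_const (y := 1 / 2)).tendsto 0 |>.comp hsq
    rw [ENNReal.zero_rpow_of_pos (by norm_num)] at h3
    refine h3.congr fun k => ?_
    simp only [Function.comp_apply]
    rw [← ENNReal.rpow_natCast, ← ENNReal.rpow_mul]
    norm_num
  have hk : ∀ k, ‖D ((hL k).toLp _)‖ ≤ c * ‖(hL k).toLp _‖ := fun k =>
    h k _ (hηm.indicator (hS k)) (hL k) (fun x hx => by simp [hx])
  exact le_of_tendsto_of_tendsto' ((D.continuous.tendsto η).comp ht).norm (ht.norm.const_mul c) hk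

lemma exists_cut (R1 C : ℝ) {ε : ℝ} (hε : 0 < ε) : ∃ R2 : ℝ, ∃ χ0 χ1 : ℝ → ℝ,
    Continuous χ0 ∧ Continuous χ1 ∧ (∀ t, χ0 t ^ 2 + χ1 t ^ 2 = 1) ∧ (∀ t ≤ R1, χ1 t = 0) ∧
    (∀ t ≥ R2, χ0 t = 0) ∧ (∀ t h, |h| ≤ C → |χ0 (t + h) - χ0 t| ≤ ε) ∧
    (∀ t h, |h| ≤ C → |χ1 (t + h) - χ1 t| ≤ ε) := by
  set D : ℝ := 2 * (|C| + 1) / ε with hD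
  have hDp : 0 < D := by positivity
  set θ : ℝ → ℝ := fun t => Real.pi / 2 * max 0 (min 1 ((t - R1) / D)) with hθ
  have hθc : Continuous θ := by fun_prop
  have hlip : ∀ t h, |h| ≤ C → |θ (t + h) - θ t| ≤ ε := by
    intro t h hh
    simp only [hθ]
    rw [← mul_sub, abs_mul, abs_of_pos (by positivity)]
    have h1 : |max 0 (min 1 ((t + h - R1) / D)) - max 0 (min 1 ((t - R1) / D))| ≤ |h| / D := by
      refine (abs_max_sub_max_le_max _ _ _ _).trans ?_
      refine max_le (by simp; positivity) ?_
      refine (abs_min_sub_min_le_max _ _ _ _).trans ?_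
      refine max_le (by simp; positivity) ?_
      rw [← sub_div, abs_div, abs_of_pos hDp]
      apply le_of_eq; ring_nf
    calc _ ≤ 2 * (|h| / D) := by
          gcongr
          linarith [Real.pi_le_four]
      _ ≤ 2 * ((|C| + 1) / D) := by
          gcongr; linarith [le_abs_self C]
      _ = ε := by rw [hD]; field_simp
  refine ⟨R1 + D, fun t => Real.cos (θ t), fun t => Real.sin (θ t), by fun_prop, by fun_prop,
    fun t => Real.cos_sq_add_sin_sq _, ?_, ?_, ?_, ?_⟩
  · intro t ht
    have : (t - R1) / D ≤ 0 := div_nonpos_of_nonpos_of_nonneg (by linarith) hDp.le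
    simp only [hθ]
    rw [max_eq_left ((min_le_right _ _).trans this)]; simp
  · intro t ht
    have : 1 ≤ (t - R1) / D := by rw [le_div_iff₀ hDp]; linarith
    simp only [hθ]
    rw [min_eq_left this, max_eq_right zero_le_one]; simp
  · intro t h hh
    exact (Real.abs_cos_sub_cos_le _ _).trans (hlip t h hh)
  · intro t h hh
    exact (Real.abs_sin_sub_sin_le _ _).trans (hlip t h hh)

section gen3
variable {E : Type*} [NormedAddCommGroup E] [NormedSpace ℝ E] [FiniteDimensional ℝ E]
  [MeasureSpace E] [BorelSpace E] [SecondCountableTopology E]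
  [(volume : Measure E).IsAddHaarMeasure]

lemma exists_window (C : ℝ) {ε : ℝ} (hε : 0 < ε) : ∃ R A : ℝ, ∃ φ : E → ℝ, 0 < R ∧ Measurable φ ∧
    (∀ v, ‖φ v‖ ≤ A) ∧ (∀ v, R < ‖v‖ → φ v = 0) ∧ ∫⁻ v, ‖φ v‖ₑ ^ 2 = 1 ∧
    ∀ w, ‖w‖ ≤ C → ∫⁻ v, ‖φ (v + w) - φ v‖ₑ ^ 2 ≤ ENNReal.ofReal ε := by
  set d := Module.finrank ℝ E
  have hlim : Tendsto (fun R : ℝ => (1 + C * R⁻¹) ^ d - (1 - C * R⁻¹) ^ d) atTop (𝓝 0) := by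
    have hc : Continuous (fun t : ℝ => (1 + C * t) ^ d - (1 - C * t) ^ d) := by fun_prop
    have := (hc.tendsto 0).comp tendsto_inv_atTop_zero
    simpa [Function.comp_def] using this
  obtain ⟨R, hR, hRC, hR0⟩ := ((hlim.eventually (gt_mem_nhds hε)).and
    ((eventually_gt_atTop |C|).and (eventually_gt_atTop 0))).exists
  set b : ENNReal := volume (Metric.ball (0:E) 1) with hb
  have hb0 : b ≠ 0 := (Metric.measure_ball_pos _ _ one_pos).ne'
  have hb1 : b ≠ ⊤ := measure_ball_lt_top.ne
  have hvol : ∀ r, 0 ≤ r → volume (Metric.closedBall (0:E) r) = ENNReal.ofReal (r ^ d) * b :=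
    fun r hr => Measure.addHaar_closedBall _ _ hr
  have hbr : 0 < b.toReal := ENNReal.toReal_pos hb0 hb1
  set a : ℝ := (Real.sqrt (R ^ d * b.toReal))⁻¹ with ha
  have ha2 : a ^ 2 = (R ^ d * b.toReal)⁻¹ := by
    rw [ha, inv_pow, Real.sq_sqrt (by positivity)]
  have hae : ‖a‖ₑ ^ 2 = ENNReal.ofReal ((R ^ d * b.toReal)⁻¹) := by
    rw [← ha2, ← ofReal_norm, ← ENNReal.ofReal_pow (norm_nonneg _), Real.norm_eq_abs, sq_abs]
  have hbR : b = ENNReal.ofReal b.toReal := (ENNReal.ofReal_toReal hb1).symm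
  have hm : ∀ r, MeasurableSet (Metric.closedBall (0:E) r) :=
    fun r => Metric.isClosed_closedBall.measurableSet
  have hRC' := abs_lt.1 hRC
  refine ⟨R, |a|, (Metric.closedBall 0 R).indicator (fun _ => a), hR0,
    measurable_const.indicator (hm R), ?_, ?_, ?_, ?_⟩
  · intro v
    by_cases hv : v ∈ Metric.closedBall (0:E) R <;> simp [indicator, hv]
  · intro v hv
    exact indicator_of_notMem (by simpa using hv) _
  · have : ∀ v, ‖(Metric.closedBall (0:E) R).indicator (fun _ => a) v‖ₑ ^ 2 =
        (Metric.closedBall (0:E) R).indicator (fun _ => ‖a‖ₑ ^ 2) v := by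
      intro v
      by_cases hv : v ∈ Metric.closedBall (0:E) R
      · rw [indicator_of_mem hv, indicator_of_mem hv]
      · rw [indicator_of_notMem hv, indicator_of_notMem hv]; simp
    simp only [this]
    rw [lintegral_indicator_const (hm R), hvol R hR0.le, hae, hbR,
      ← ENNReal.ofReal_mul (by positivity), ← ENNReal.ofReal_mul (by positivity),
      ENNReal.toReal_ofReal hbr.le, inv_mul_cancel₀ (by positivity), ENNReal.ofReal_one]
  · intro w hw
    have hC0 : 0 ≤ C := (norm_nonneg _).trans hw
    calc _ ≤ ∫⁻ v, (Metric.closedBall (0:E) (R + C) \ Metric.closedBall 0 (R - C)).indicator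
          (fun _ => ‖a‖ₑ ^ 2) v := by
          gcongr with v
          by_cases hv : v ∈ (Metric.closedBall (0:E) (R + C) \ Metric.closedBall 0 (R - C))
          · rw [indicator_of_mem hv]
            gcongr
            simp only [indicator]
            split_ifs <;> simp
          · have : (Metric.closedBall (0:E) R).indicator (fun _ => a) (v + w) =
              (Metric.closedBall (0:E) R).indicator (fun _ => a) v := by
              simp only [Set.mem_sdiff, Metric.mem_closedBall, dist_zero_right, not_and, not_not] at hv
              simp only [indicator, Metric.mem_closedBall, dist_zero_right]
              have t1 := norm_add_le v w
              have t2 := norm_sub_le (v + w) w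
              rw [add_sub_cancel_right] at t2
              by_cases h2 : ‖v‖ ≤ R + C
              · have := hv h2
                rw [if_pos (by linarith), if_pos (by linarith)]
              · push Not at h2
                rw [if_neg (by linarith), if_neg (by linarith)]
            rw [this]; simp
      _ ≤ ENNReal.ofReal ε := by
          rw [lintegral_indicator_const ((hm _).diff (hm _)),
            measure_sdiff (Metric.closedBall_subset_closedBall (by linarith)) (hm _).nullMeasurableSet
              measure_closedBall_lt_top.ne, hvol _ (by linarith), hvol _ (by linarith), hae, hbR,
            ← ENNReal.ofReal_mul (by positivity),
            ← ENNReal.ofReal_mul (pow_nonneg (by linarith) _),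
            ← ENNReal.ofReal_sub _ (mul_nonneg (pow_nonneg (by linarith) _) hbr.le),
            ← ENNReal.ofReal_mul (by positivity), ENNReal.toReal_ofReal hbr.le]
          apply ENNReal.ofReal_le_ofReal
          refine le_of_eq_of_le ?_ hR.le
          have e1 : 1 + C * R⁻¹ = (R + C) / R := by field_simp
          have e3 : 1 - C * R⁻¹ = (R - C) / R := by field_simp
          rw [e1, e3, div_pow, div_pow]
          field_simp

lemma combine {k : E → E → ℂ} {s : ℝ} {m e : ENNReal} {M C : ℝ} (hk : KReg k M C)
    {χ0 χ1 : E → ℝ} (h0m : Measurable χ0) (h1m : Measurable χ1)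
    (hχ : ∀ x, χ0 x ^ 2 + χ1 x ^ 2 = 1)
    (h0 : ∀ ξ : E → ℂ, Measurable ξ → MemLp ξ 2 → eLpNorm (fun x => (χ0 x : ℂ) * Op k s ξ x) 2 ≤
      m * eLpNorm (fun x => (χ0 x : ℂ) * ξ x) 2 + e * eLpNorm ξ 2)
    (h1 : ∀ ξ : E → ℂ, Measurable ξ → MemLp ξ 2 → eLpNorm (fun x => (χ1 x : ℂ) * Op k s ξ x) 2 ≤
      m * eLpNorm (fun x => (χ1 x : ℂ) * ξ x) 2 + e * eLpNorm ξ 2) :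
    OpBound k s (m + 2 * e) := by
  intro ξ hm hL
  have hs : ∀ g : E → ℂ, Measurable g → eLpNorm g 2 ^ 2 =
      eLpNorm (fun x => (χ0 x : ℂ) * g x) 2 ^ 2 + eLpNorm (fun x => (χ1 x : ℂ) * g x) 2 ^ 2 := by
    intro g hg
    rw [e2, e2, e2, ← lintegral_add_left (by fun_prop)]
    refine lintegral_congr fun x => ?_
    rw [enorm_mul, enorm_mul, mul_pow, mul_pow, ← add_mul, enorm_re, enorm_re]
    have : ‖χ0 x‖ₑ ^ 2 + ‖χ1 x‖ₑ ^ 2 = 1 := by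
      rw [← ofReal_norm, ← ofReal_norm, ← ENNReal.ofReal_pow (norm_nonneg _),
        ← ENNReal.ofReal_pow (norm_nonneg _), ← ENNReal.ofReal_add (by positivity) (by positivity)]
      simp [hχ x]
    rw [this, one_mul]
  have hO := hs _ (Op_meas (s := s) hk hm)
  have hx := hs _ hm
  have a0 := h0 ξ hm hL
  have a1 := h1 ξ hm hL
  set x0 := eLpNorm (fun x => (χ0 x : ℂ) * ξ x) 2
  set x1 := eLpNorm (fun x => (χ1 x : ℂ) * ξ x) 2
  set x := eLpNorm ξ 2
  have l0 : x0 ≤ x := sq_le_iff.1 (by rw [hx]; exact le_self_add)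
  have l1 : x1 ≤ x := sq_le_iff.1 (by rw [hx]; exact le_add_self)
  apply sq_le_iff.1
  rw [hO]
  calc _ ≤ (m * x0 + e * x) ^ 2 + (m * x1 + e * x) ^ 2 := by gcongr
    _ = m ^ 2 * (x0 ^ 2 + x1 ^ 2) + 2 * m * e * x * x0 + 2 * m * e * x * x1 + 2 * (e * x) ^ 2 := by
        ring
    _ ≤ m ^ 2 * x ^ 2 + 2 * m * e * x * x + 2 * m * e * x * x + (2 * (e * x) ^ 2
        + 2 * (e * x) ^ 2) := by
        rw [hx]
        gcongr
        exact le_self_add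
    _ = _ := by ring
end gen3

instance haarEf (n : ℕ) : (volume : Measure (Ef n)).IsAddHaarMeasure :=
  inferInstanceAs ((volume : Measure (Eb n)).prod (volume : Measure ℝ)).IsAddHaarMeasure

instance sfPlus (n : ℕ) : SFinite (muPlus n) := by unfold muPlus; infer_instance

def aK {n : ℕ} (f : Ef n × Ef n → ℂ) (K : Eb n × Eb n × ℝ × ℝ → ℂ) (x : Ef n) (t : ℝ) (w : Ef n) :
    ℂ := f (x, w) + K (x.1, w.1, t, t - w.2)

def kA {n : ℕ} (f : Ef n × Ef n → ℂ) (K : Eb n × Eb n × ℝ × ℝ → ℂ) (s : ℝ) (x w : Ef n) : ℂ :=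
  if 0 ≤ x.2 ∧ 0 ≤ x.2 - s * w.2 then aK f K x (x.2 / s) w else 0

def qB {n : ℕ} (f : Ef n × Ef n → ℂ) (K : Eb n × Eb n × ℝ × ℝ → ℂ) (y : Eb n) (v w : Ef n) : ℂ :=
  if 0 ≤ v.2 ∧ 0 ≤ v.2 - w.2 then aK f K (y, 0) v.2 w else 0

def qP {n : ℕ} (f : Ef n × Ef n → ℂ) (y v w : Ef n) : ℂ := f (y, w)

structure FK {n : ℕ} (f : Ef n × Ef n → ℂ) (K : Eb n × Eb n × ℝ × ℝ → ℂ) (M C : ℝ) : Prop where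
  fu : UniformContinuous f
  Ku : UniformContinuous K
  fb : ∀ p, ‖f p‖ ≤ M / 2
  Kb : ∀ p, ‖K p‖ ≤ M / 2
  C0 : 0 < C
  fs : ∀ p, C / 2 < ‖p‖ → f p = 0
  Ks : ∀ p, C / 2 < ‖p‖ → K p = 0

lemma exists_FK {n : ℕ} {f : Ef n × Ef n → ℂ} {K : Eb n × Eb n × ℝ × ℝ → ℂ}
    (hf : Continuous f) (hf' : HasCompactSupport f) (hK : Continuous K) (hK' : HasCompactSupport K) :
    ∃ M C, FK f K M C := by
  obtain ⟨M1, h1⟩ := hf'.exists_bound_of_continuous hf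
  obtain ⟨M2, h2⟩ := hK'.exists_bound_of_continuous hK
  obtain ⟨C1, c1⟩ := hf'.isCompact.isBounded.subset_closedBall (0 : Ef n × Ef n)
  obtain ⟨C2, c2⟩ := hK'.isCompact.isBounded.subset_closedBall (0 : Eb n × Eb n × ℝ × ℝ)
  refine ⟨2 * max M1 M2, 2 * max 1 (max C1 C2), ⟨hf'.uniformContinuous_of_continuous hf,
    hK'.uniformContinuous_of_continuous hK, ?_, ?_, by positivity, ?_, ?_⟩⟩
  · intro p; have := le_max_left M1 M2; have := h1 p; linarith
  · intro p; have := le_max_right M1 M2; have := h2 p; linarith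
  · intro p hp
    by_contra h
    have h3 := c1 (subset_tsupport f h)
    rw [Metric.mem_closedBall, dist_zero_right] at h3
    have := le_max_right 1 (max C1 C2); have := le_max_left C1 C2
    linarith
  · intro p hp
    by_contra h
    have h3 := c2 (subset_tsupport K h)
    rw [Metric.mem_closedBall, dist_zero_right] at h3
    have := le_max_right 1 (max C1 C2); have := le_max_right C1 C2
    linarith

section
variable {n : ℕ} {f : Ef n × Ef n → ℂ} {K : Eb n × Eb n × ℝ × ℝ → ℂ} {M C : ℝ}

lemma FK.M0 (h : FK f K M C) : 0 ≤ M := by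
  have := (norm_nonneg _).trans (h.fb 0); linarith

lemma FK.fz (h : FK f K M C) (x w : Ef n) (hw : C < ‖w‖) : f (x, w) = 0 := by
  apply h.fs
  have : ‖w‖ ≤ ‖(x, w)‖ := le_max_right _ _
  have := h.C0
  linarith

lemma FK.Kt (h : FK f K M C) (x w : Eb n) (t r : ℝ) (hw : C / 2 < |t|) : K (x, w, t, r) = 0 := by
  apply h.Ks
  have h1 : ‖(t, r)‖ ≤ ‖(x, w, t, r)‖ := (le_max_right _ _).trans (le_max_right _ _)
  have h2 : |t| ≤ ‖(t, r)‖ := le_max_left _ _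
  linarith

lemma FK.Kr (h : FK f K M C) (x w : Eb n) (t r : ℝ) (hw : C / 2 < |r|) : K (x, w, t, r) = 0 := by
  apply h.Ks
  have h1 : ‖(t, r)‖ ≤ ‖(x, w, t, r)‖ := (le_max_right _ _).trans (le_max_right _ _)
  have h2 : |r| ≤ ‖(t, r)‖ := le_max_right _ _
  linarith

lemma FK.Kw (h : FK f K M C) (x w : Eb n) (t r : ℝ) (hw : C / 2 < ‖w‖) : K (x, w, t, r) = 0 := by
  apply h.Ks
  have h1 : ‖w‖ ≤ ‖(x, w, t, r)‖ := (le_max_left _ _).trans (le_max_right _ _)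
  linarith

lemma FK.Kz (h : FK f K M C) (x : Eb n) (t : ℝ) (w : Ef n) (hw : C < ‖w‖) :
    K (x, w.1, t, t - w.2) = 0 := by
  have hC := h.C0
  rcases lt_max_iff.1 (show C < max ‖w.1‖ ‖w.2‖ from hw) with h1 | h1
  · exact h.Kw _ _ _ _ (by linarith)
  · by_cases ht : C / 2 < |t|
    · exact h.Kt _ _ _ _ ht
    · apply h.Kr
      rw [Real.norm_eq_abs] at h1
      have h3 : |w.2| ≤ |t| + |t - w.2| := by
        have := abs_sub t (t - w.2)
        simpa using this
      linarith

lemma FK.az (h : FK f K M C) (x : Ef n) (t : ℝ) (w : Ef n) (hw : C < ‖w‖) : aK f K x t w = 0 := by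
  rw [aK, h.fz x w hw, h.Kz x.1 t w hw, add_zero]

lemma FK.ab (h : FK f K M C) (x : Ef n) (t : ℝ) (w : Ef n) : ‖aK f K x t w‖ ≤ M := by
  have := norm_add_le (f (x, w)) (K (x.1, w.1, t, t - w.2))
  have := h.fb (x, w)
  have := h.Kb (x.1, w.1, t, t - w.2)
  rw [aK]; linarith

lemma FK.am (h : FK f K M C) : Measurable (fun p : Ef n × ℝ × Ef n => aK f K p.1 p.2.1 p.2.2) := by
  have h1 := h.fu.continuous
  have h2 := h.Ku.continuous
  apply Continuous.measurable
  unfold aK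
  fun_prop

lemma FK.regA (h : FK f K M C) (s : ℝ) : KReg (kA f K s) M C := by
  refine ⟨?_, ?_, ?_⟩
  · refine Measurable.ite ?_ ?_ measurable_const
    · exact (measurableSet_le (f := fun _ => (0:ℝ)) (g := fun p : Ef n × Ef n => p.1.2)
        measurable_const (by fun_prop)).inter
        (measurableSet_le (f := fun _ => (0:ℝ)) (g := fun p : Ef n × Ef n => p.1.2 - s * p.2.2)
        measurable_const (by fun_prop))
    · exact h.am.comp (f := fun p : Ef n × Ef n => (p.1, p.1.2 / s, p.2)) (by fun_prop)
  · intro x w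
    rw [kA]; split_ifs
    · exact h.ab _ _ _
    · simpa using h.M0
  · intro x w hw
    rw [kA]; split_ifs
    · exact h.az _ _ _ hw
    · rfl

lemma FK.regB (h : FK f K M C) : KReg (fun p : Eb n × Ef n => qB f K p.1 p.2) M C := by
  refine ⟨?_, ?_, ?_⟩
  · refine Measurable.ite ?_ ?_ measurable_const
    · exact (measurableSet_le (f := fun _ => (0:ℝ)) (g := fun p : (Eb n × Ef n) × Ef n => p.1.2.2)
        measurable_const (by fun_prop)).inter
        (measurableSet_le (f := fun _ => (0:ℝ))
        (g := fun p : (Eb n × Ef n) × Ef n => p.1.2.2 - p.2.2)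
        measurable_const (by fun_prop))
    · exact h.am.comp (f := fun p : (Eb n × Ef n) × Ef n =>
        (((p.1.1, 0) : Ef n), p.1.2.2, p.2)) (by fun_prop)
  · intro x w
    simp only [qB]; split_ifs
    · exact h.ab _ _ _
    · simpa using h.M0
  · intro x w hw
    simp only [qB]; split_ifs
    · exact h.az _ _ _ hw
    · rfl

lemma FK.regP (h : FK f K M C) : KReg (fun p : Ef n × Ef n => qP f p.1 p.2) M C := by
  refine ⟨?_, ?_, ?_⟩
  · exact h.fu.continuous.measurable.comp (f := fun p : (Ef n × Ef n) × Ef n => (p.1.1, p.2))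
      (by fun_prop)
  · intro x w
    have := h.fb (x.1, w); have := h.M0
    simp only [qP]; linarith
  · intro x w hw
    exact h.fz _ _ hw

lemma FK.closeP (h : FK f K M C) (R : ℝ) {ε : ℝ} (hε : 0 < ε) : ∃ δ > 0, ∀ s, 0 < s → s < δ →
    ∀ y u w : Ef n, ‖w‖ ≤ C → ‖u‖ ≤ R → 2 * C ≤ y.2 / s + u.2 →
      ‖kA f K s (y + s • (u + w)) w - qP f y (u + w) w‖ ≤ ε := by
  obtain ⟨η, hη, H⟩ := Metric.uniformContinuous_iff.1 h.fu ε hε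
  have hC := h.C0
  refine ⟨η / (|R| + C + 1), by positivity, fun s hs hsδ y u w hw hu hyu => ?_⟩
  rw [lt_div_iff₀ (by positivity)] at hsδ
  have hw2 : |w.2| ≤ C := (le_max_right ‖w.1‖ ‖w.2‖ : |w.2| ≤ ‖w‖).trans hw
  have hx2 : (y + s • (u + w)).2 = s * (y.2 / s + u.2 + w.2) := by
    simp only [Prod.snd_add, Prod.smul_snd, smul_eq_mul]; field_simp; ring
  have hxs : (y + s • (u + w)).2 / s = y.2 / s + u.2 + w.2 := by
    rw [hx2]; field_simp
  have hab := abs_le.1 hw2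
  have hpos : C ≤ y.2 / s + u.2 + w.2 := by linarith
  have hcond : 0 ≤ (y + s • (u + w)).2 ∧ 0 ≤ (y + s • (u + w)).2 - s * w.2 := by
    rw [hx2]
    refine ⟨by have : 0 ≤ y.2 / s + u.2 + w.2 := by linarith
               positivity, ?_⟩
    rw [← mul_sub]
    have : 0 ≤ y.2 / s + u.2 + w.2 - w.2 := by linarith
    positivity
  rw [kA, if_pos hcond, aK, hxs, h.Kt _ _ _ _ (by rw [abs_of_nonneg (by linarith)]; linarith),
    add_zero, qP, ← dist_eq_norm]
  refine (H ?_).le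
  rw [Prod.dist_eq]
  simp only [dist_self]
  rw [dist_eq_norm, add_sub_cancel_left, norm_smul, Real.norm_eq_abs, abs_of_pos hs]
  refine max_lt ?_ hη
  refine lt_of_le_of_lt ?_ hsδ
  have := norm_add_le u w
  have := le_abs_self R
  gcongr
  linarith

lemma FK.closeB (h : FK f K M C) (R : ℝ) {ε : ℝ} (hε : 0 < ε) : ∃ δ > 0, ∀ s, 0 < s → s < δ →
    ∀ (y : Eb n) (u w : Ef n), ‖w‖ ≤ C → ‖u.1‖ ≤ R → u.2 ≤ R →
      ‖kA f K s ((y, 0) + s • (u + w)) w - qB f K y (u + w) w‖ ≤ ε := by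
  obtain ⟨η, hη, H⟩ := Metric.uniformContinuous_iff.1 h.fu (ε / 2) (by positivity)
  obtain ⟨η', hη', H'⟩ := Metric.uniformContinuous_iff.1 h.Ku (ε / 2) (by positivity)
  have hC := h.C0
  refine ⟨min η η' / (|R| + C + 1), by positivity, fun s hs hsδ y u w hw hu1 hu2 => ?_⟩
  rw [lt_div_iff₀ (by positivity)] at hsδ
  have hx2 : (((y, 0) : Ef n) + s • (u + w)).2 = s * (u.2 + w.2) := by
    simp; ring
  have hxs : (((y, 0) : Ef n) + s • (u + w)).2 / s = (u + w).2 := by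
    rw [hx2]; simp; field_simp
  have hiff : (0 ≤ (((y, 0) : Ef n) + s • (u + w)).2 ∧
      0 ≤ (((y, 0) : Ef n) + s • (u + w)).2 - s * w.2) ↔
      (0 ≤ (u + w).2 ∧ 0 ≤ (u + w).2 - w.2) := by
    rw [hx2, ← mul_sub, Prod.snd_add, mul_nonneg_iff_of_pos_left hs, mul_nonneg_iff_of_pos_left hs]
  rw [kA, qB]
  by_cases hc : (0 ≤ (u + w).2 ∧ 0 ≤ (u + w).2 - w.2)
  · rw [if_pos (hiff.2 hc), if_pos hc, hxs, aK, aK, add_sub_add_comm]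
    have hu0 : 0 ≤ u.2 := by simpa using hc.2
    have hu : ‖u‖ ≤ |R| := by
      refine max_le (hu1.trans (le_abs_self R)) ?_
      rw [Real.norm_eq_abs, abs_of_nonneg hu0]
      exact hu2.trans (le_abs_self R)
    have hd : ‖s • (u + w)‖ < min η η' := by
      rw [norm_smul, Real.norm_eq_abs, abs_of_pos hs]
      refine lt_of_le_of_lt ?_ hsδ
      have := norm_add_le u w
      gcongr
      linarith
    refine (norm_add_le _ _).trans ?_
    have a1 : ‖f (((y, 0) : Ef n) + s • (u + w), w) - f ((y, 0), w)‖ ≤ ε / 2 := by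
      rw [← dist_eq_norm]
      refine (H ?_).le
      rw [Prod.dist_eq]
      simp only [dist_self]
      rw [dist_eq_norm, add_sub_cancel_left]
      exact max_lt (hd.trans_le (min_le_left _ _)) hη
    have a2 : ‖K ((((y, 0) : Ef n) + s • (u + w)).1, w.1, (u + w).2, (u + w).2 - w.2)
        - K (y, w.1, (u + w).2, (u + w).2 - w.2)‖ ≤ ε / 2 := by
      rw [← dist_eq_norm]
      refine (H' ?_).le
      rw [Prod.dist_eq]
      simp only [dist_self]
      rw [dist_eq_norm, Prod.fst_add, add_sub_cancel_left]
      refine max_lt ?_ hη'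
      exact ((le_max_left _ _ : ‖(s • (u + w)).1‖ ≤ ‖s • (u + w)‖).trans_lt hd).trans_le
        (min_le_right _ _)
    linarith
  · rw [if_neg (fun hh => hc (hiff.1 hh)), if_neg hc]
    simpa using hε.le
end

section
variable {n : ℕ} {f : Ef n × Ef n → ℂ} {K : Eb n × Eb n × ℝ × ℝ → ℂ} {M C : ℝ}

lemma halfMeas (n : ℕ) : MeasurableSet {p : Ef n | 0 ≤ p.2} :=
  measurableSet_le measurable_const measurable_snd

/-- A double integral with kernel `k` on `y_n > 0` against a representative. -/
lemma fub {k : Ef n → ℂ} {ξ η : Ef n → ℂ} {x : Ef n} {s : ℝ} (hs : 0 < s)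
    (hae : ∀ᵐ w : Ef n, 0 ≤ (x - s • w).2 → η (x - s • w) = ξ (x - s • w))
    (hi : Integrable (fun w : Ef n => (if 0 ≤ x.2 - s * w.2 then k w else 0) * ξ (x - s • w))) :
    ∫ w : Ef n, (if 0 ≤ x.2 - s * w.2 then k w else 0) * ξ (x - s • w) =
      ∫ y' : Eb n, ∫ yn in Ioi (0:ℝ), k (y', x.2 / s - yn) * η (x.1 - s • y', s * yn) := by
  have e := integral_prod (μ := (volume : Measure (Eb n))) (ν := (volume : Measure ℝ)) _ hi
  refine (Eq.trans ?_ e).trans ?_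
  · rfl
  have hae' := Measure.ae_ae_of_ae_prod (μ := (volume : Measure (Eb n))) (ν := (volume : Measure ℝ)) hae
  refine integral_congr_ae ?_
  filter_upwards [hae'] with w' hw'
  have h2 := (Measure.measurePreserving_sub_left (volume : Measure ℝ) (x.2 / s)).quasiMeasurePreserving.ae hw'
  rw [← integral_sub_left_eq_self _ volume (x.2 / s), ← integral_indicator measurableSet_Ioi]
  refine integral_congr_ae ?_
  have h0 : ∀ᵐ t : ℝ, t ≠ 0 := by simp [ae_iff]
  filter_upwards [h2, h0] with t ht ht0
  have e1 : x - s • ((w', x.2 / s - t) : Ef n) = (x.1 - s • w', s * t) := by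
    ext1
    · simp
    · simp; field_simp; ring
  have e2 : x.2 - s * (x.2 / s - t) = s * t := by field_simp; ring
  simp only [e1, e2] at ht ⊢
  simp only [mul_nonneg_iff_of_pos_left hs] at ht ⊢
  by_cases h : 0 < t
  · rw [indicator_of_mem (by exact h), if_pos h.le, ht h.le]
  · rw [indicator_of_notMem (by exact h), if_neg, zero_mul]
    intro h3; exact h (lt_of_le_of_ne h3 ht0.symm)

lemma FK.op_eq (h : FK f K M C) {s : ℝ} (hs : 0 < s) {ξ η : Ef n → ℂ} (hL : MemLp ξ 2)
    (hη : η =ᵐ[muPlus n] ξ) {x : Ef n} (hx : 0 ≤ x.2) :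
    (∫ v in {v : Ef n | s * v.2 ≤ x.2}, f (x, v) * (η (x.1 - s • v.1, x.2 - s * v.2))) +
    (∫ y' : Eb n, ∫ yn in Ioi (0:ℝ), K (x.1, y', x.2 / s, yn) * (η (x.1 - s • y', s * yn))) =
    Op (kA f K s) s ξ x := by
  have hae : ∀ᵐ z : Ef n, 0 ≤ z.2 → η z = ξ z := (ae_restrict_iff' (halfMeas n)).1 hη
  have hae := qmp x hs.ne' hae
  have mset : MeasurableSet {w : Ef n | 0 ≤ x.2 - s * w.2} :=
    measurableSet_le measurable_const (by fun_prop)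
  have hM := h.M0
  have i1 : Integrable (fun w : Ef n => (if 0 ≤ x.2 - s * w.2 then f (x, w) else 0) * ξ (x - s • w)) := by
    refine intg' hL x hs.ne' C (M := M) ?_ ?_ ?_
    · have := h.fu.continuous
      exact (Measurable.ite mset (Continuous.measurable (by fun_prop))
        measurable_const).aestronglyMeasurable
    · intro w; have := h.fb (x, w); split_ifs
      · linarith
      · simpa using hM
    · intro w hw; rw [h.fz _ _ hw]; simp
  have i2 : Integrable (fun w : Ef n => (if 0 ≤ x.2 - s * w.2 then
      K (x.1, w.1, x.2 / s, x.2 / s - w.2) else 0) * ξ (x - s • w)) := by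
    refine intg' hL x hs.ne' C (M := M) ?_ ?_ ?_
    · have := h.Ku.continuous
      exact (Measurable.ite mset (Continuous.measurable (by fun_prop))
        measurable_const).aestronglyMeasurable
    · intro w; have := h.Kb (x.1, w.1, x.2 / s, x.2 / s - w.2); split_ifs
      · linarith
      · simpa using hM
    · intro w hw; rw [h.Kz _ _ _ hw]; simp
  have e0 : Op (kA f K s) s ξ x =
    (∫ w : Ef n, (if 0 ≤ x.2 - s * w.2 then f (x, w) else 0) * ξ (x - s • w)) +
    ∫ w : Ef n, (if 0 ≤ x.2 - s * w.2 then
      K (x.1, w.1, x.2 / s, x.2 / s - w.2) else 0) * ξ (x - s • w) := by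
    rw [← integral_add i1 i2, Op]
    congr 1; ext w
    simp only [kA, hx, true_and, aK]
    split_ifs <;> ring
  rw [e0, fub hs hae i2]
  congr 1
  · rw [← integral_indicator (by simpa using mset)]
    refine integral_congr_ae ?_
    filter_upwards [hae] with w hw
    have e1 : ((x.1 - s • w.1, x.2 - s * w.2) : Ef n) = x - s • w := rfl
    by_cases h3 : s * w.2 ≤ x.2
    · rw [indicator_of_mem (by exact h3), if_pos (by linarith), e1, hw (by simpa using h3)]
    · rw [indicator_of_notMem (by exact h3), if_neg (by linarith), zero_mul]
  · simp only [sub_sub_cancel]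

lemma FK.bridgeA (h : FK f K M C) {s : ℝ} (hs : 0 < s) {T S : HS n →L[ℂ] HS n}
    (hT : rhoSpec n s f T) (hS : kappaSpec n s K S) {ξ : Ef n → ℂ} {η : HS n} (hL : MemLp ξ 2)
    (hη : η =ᵐ[muPlus n] ξ) : (T + S) η =ᵐ[muPlus n] Op (kA f K s) s ξ := by
  have h1 := hT η
  have h2 := hS η
  have h3 := Lp.coeFn_add (T η) (S η)
  have h4 : ∀ᵐ x ∂(muPlus n), 0 ≤ x.2 := ae_restrict_mem (halfMeas n)
  filter_upwards [h1, h2, h3, h4] with x h1 h2 h3 h4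
  rw [add_apply, h3, Pi.add_apply, h1, h2, h.op_eq hs hL hη h4]

lemma Op_off {s : ℝ} {ξ : Ef n → ℂ} {x : Ef n} (hx : ¬ 0 ≤ x.2) : Op (kA f K s) s ξ x = 0 := by
  rw [Op]; simp [kA, hx]

lemma eLp_off {g : Ef n → ℂ} (hg : ∀ x, ¬ 0 ≤ x.2 → g x = 0) :
    eLpNorm g 2 (muPlus n) = eLpNorm g 2 volume := by
  apply eLpNorm_restrict_eq_of_support_subset
  intro x hx
  by_contra h
  exact hx (hg x h)

lemma FK.boundA (h : FK f K M C) {s : ℝ} (hs : 0 < s) {T S : HS n →L[ℂ] HS n}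
    (hT : rhoSpec n s f T) (hS : kappaSpec n s K S) : OpBound (kA f K s) s ‖T + S‖ₑ := by
  intro ξ hm hL
  have hL' : MemLp ξ 2 (muPlus n) := hL.mono_measure Measure.restrict_le_self
  have h1 := h.bridgeA hs hT hS hL hL'.coeFn_toLp
  rw [← eLp_off (fun x hx => Op_off hx), ← eLpNorm_congr_ae h1, ← Lp.enorm_def]
  refine ((T + S).le_opENorm _).trans ?_
  rw [Lp.enorm_toLp]
  gcongr
  exact Measure.restrict_le_self

lemma FK.boundA' (h : FK f K M C) {s : ℝ} (hs : 0 < s) {T S : HS n →L[ℂ] HS n}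
    (hT : rhoSpec n s f T) (hS : kappaSpec n s K S) {c : ℝ} (hc : 0 ≤ c)
    (hb : OpBound (kA f K s) s (ENNReal.ofReal c)) : ‖T + S‖ ≤ c := by
  refine ContinuousLinearMap.opNorm_le_bound _ hc fun η => ?_
  set ξ : Ef n → ℂ := {p : Ef n | 0 ≤ p.2}.indicator η with hξ
  have hm : Measurable ξ := (Lp.stronglyMeasurable η).measurable.indicator (halfMeas n)
  have hL : MemLp ξ 2 := (memLp_indicator_iff_restrict (halfMeas n)).2 (Lp.memLp η)
  have hη : η =ᵐ[muPlus n] ξ := (indicator_ae_eq_restrict (halfMeas n)).symm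
  have h1 := h.bridgeA hs hT hS hL hη
  have h2 := hb ξ hm hL
  rw [← eLp_off (fun x hx => Op_off hx), ← eLpNorm_congr_ae h1, ← eLp_off (g := ξ) (fun x hx => by
    rw [hξ, indicator_of_notMem]; exact hx), ← eLpNorm_congr_ae hη] at h2
  rw [← Lp.enorm_def, ← Lp.enorm_def, ← ofReal_norm, ← ofReal_norm, ← ENNReal.ofReal_mul hc] at h2
  exact (ENNReal.ofReal_le_ofReal_iff (by positivity)).1 h2

end

section
variable {n : ℕ} {f : Ef n × Ef n → ℂ} {K : Eb n × Eb n × ℝ × ℝ → ℂ} {M C : ℝ}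

lemma bridgeP {P : HT n →L[ℂ] HT n} (hP : pi0Spec n f P) {ξ : Ef n × Ef n → ℂ} {η : HT n}
    (hη : η =ᵐ[muT n] ξ) : P η =ᵐ[muT n] FOp (qP f) ξ := by
  have h1 := hP η
  have h2 := Measure.ae_ae_of_ae_prod (μ := muPlus n) (ν := (volume : Measure (Ef n))) hη
  have h3 := Measure.quasiMeasurePreserving_fst (μ := muPlus n) (ν := (volume : Measure (Ef n)))
    |>.ae h2
  filter_upwards [h1, h3] with p h1 h3
  rw [h1, FOp]
  refine integral_congr_ae ?_
  have h4 := qmp p.2 one_ne_zero h3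
  filter_upwards [h4] with w hw
  rw [one_smul] at hw
  rw [qP, hw]

lemma boundP {P : HT n →L[ℂ] HT n} (hP : pi0Spec n f P) : FBound (muPlus n) (qP f) ‖P‖ₑ := by
  intro ξ hm hL
  have hL' : MemLp ξ 2 (muT n) := hL
  have h1 := bridgeP hP hL'.coeFn_toLp
  change eLpNorm _ 2 (muT n) ≤ _ * eLpNorm _ 2 (muT n)
  rw [← eLpNorm_congr_ae h1, ← Lp.enorm_def]
  refine (P.le_opENorm _).trans ?_
  rw [Lp.enorm_toLp]

lemma halfMeasB (n : ℕ) : MeasurableSet {q : Eb n × Eb n × ℝ | 0 ≤ q.2.2} :=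
  measurableSet_le measurable_const measurable_snd.snd

lemma FK.bridgeB (h : FK f K M C) {B : HB n →L[ℂ] HB n} (hB : piBSpec n f K B)
    {ξ : Eb n × Ef n → ℂ} (hm : Measurable ξ)
    (hL : MemLp ξ 2 ((volume : Measure (Eb n)).prod (volume : Measure (Ef n)))) {η : HB n}
    (hη : η =ᵐ[muB n] ξ) : B η =ᵐ[muB n] FOp (qB f K) ξ := by
  have h1 := hB η
  have h2 : ∀ᵐ q : Eb n × Eb n × ℝ, 0 ≤ q.2.2 → η q = ξ q := (ae_restrict_iff' (halfMeasB n)).1 hη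
  have h2 := Measure.ae_ae_of_ae_prod (μ := (volume : Measure (Eb n)))
    (ν := (volume : Measure (Ef n))) h2
  have h3 := Measure.quasiMeasurePreserving_fst (μ := (volume : Measure (Eb n)))
    (ν := (volume : Measure (Ef n))) |>.ae (h2.and (ae_memLp hm hL))
  have h3 : ∀ᵐ q ∂(muB n), (∀ᵐ v : Ef n, 0 ≤ v.2 → η (q.1, v) = ξ (q.1, v)) ∧
      MemLp (fun v => ξ (q.1, v)) 2 := ae_restrict_of_ae h3
  have h4 : ∀ᵐ q ∂(muB n), 0 ≤ q.2.2 := ae_restrict_mem (halfMeasB n)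
  filter_upwards [h1, h3, h4] with q h1 h3 h4
  rw [h1, FOp]
  have e0 : ∀ w : Ef n, qB f K q.1 q.2 w =
      if 0 ≤ q.2.2 - 1 * w.2 then aK f K (q.1, 0) q.2.2 w else 0 := by
    intro w; simp only [qB, h4, true_and, one_mul]
  have hae := qmp q.2 one_ne_zero h3.1
  have hi := intg' h3.2 q.2 one_ne_zero C (h.regB.aesm q) (h.regB.bdd q) (h.regB.supp q)
  simp only [e0] at hi ⊢
  have e1 := fub (k := aK f K (q.1, 0) q.2.2) (ξ := fun v => ξ (q.1, v)) (η := fun v => η (q.1, v))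
    one_pos hae hi
  simp only [one_smul] at e1
  rw [e1, ← integral_sub_left_eq_self _ volume q.2.1]
  simp only [aK, sub_sub_cancel, div_one, one_mul]

lemma FOp_off {ξ : Eb n × Ef n → ℂ} {q : Eb n × Ef n} (hx : ¬ 0 ≤ q.2.2) :
    FOp (qB f K) ξ q = 0 := by
  rw [FOp]; simp [qB, hx]

lemma eLpB_off {g : Eb n × Ef n → ℂ} (hg : ∀ x, ¬ 0 ≤ x.2.2 → g x = 0) :
    eLpNorm g 2 (muB n) = eLpNorm g 2 ((volume : Measure (Eb n)).prod (volume : Measure (Ef n))) := by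
  apply eLpNorm_restrict_eq_of_support_subset
  intro x hx
  by_contra h
  exact hx (hg x h)

lemma FK.boundB (h : FK f K M C) {B : HB n →L[ℂ] HB n} (hB : piBSpec n f K B) :
    FBound (volume : Measure (Eb n)) (qB f K) ‖B‖ₑ := by
  intro ξ hm hL
  have hL' : MemLp ξ 2 (muB n) := hL.mono_measure Measure.restrict_le_self
  have h1 := h.bridgeB hB hm hL hL'.coeFn_toLp
  rw [← eLpB_off (fun x hx => FOp_off hx), ← eLpNorm_congr_ae h1, ← Lp.enorm_def]
  refine (B.le_opENorm _).trans ?_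
  rw [Lp.enorm_toLp]
  gcongr
  exact Measure.restrict_le_self

lemma lim_le {X N V : ENNReal} {a : ℝ} (hV : V ≠ ⊤) (hN : N ≠ ⊤)
    (h : ∀ ε : ℝ, 0 < ε → X ≤ (ENNReal.ofReal a + V * ENNReal.ofReal ε) * N) :
    X ≤ ENNReal.ofReal a * N := by
  have ht : Tendsto (fun ε : ℝ => (ENNReal.ofReal a + V * ENNReal.ofReal ε) * N) (𝓝[>] 0)
      (𝓝 ((ENNReal.ofReal a + V * ENNReal.ofReal 0) * N)) := by
    refine ENNReal.Tendsto.mul_const ?_ (Or.inr hN)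
    refine tendsto_const_nhds.add ?_
    refine ENNReal.Tendsto.const_mul ?_ (Or.inr hV)
    exact (ENNReal.continuous_ofReal.tendsto 0).mono_left nhdsWithin_le_nhds
  simp only [ENNReal.ofReal_zero, mul_zero, add_zero] at ht
  refine ge_of_tendsto ht ?_
  filter_upwards [self_mem_nhdsWithin] with ε hε using h ε hε

/-- lower bound for P -/
lemma FK.lowerP (h : FK f K M C) {P : HT n →L[ℂ] HT n} (hP : pi0Spec n f P) {a : ℝ} (ha : 0 ≤ a)
    (hfr : ∃ᶠ s in 𝓝[>] (0:ℝ), OpBound (kA f K s) s (ENNReal.ofReal a)) : ‖P‖ ≤ a := by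
  have hC := h.C0
  refine dense_bound ha (fun k : ℕ => {p : Ef n × Ef n | 1 / ((k:ℝ) + 1) ≤ p.1.2 ∧ ‖p.2‖ ≤ k}) ?_ ?_ ?_
  · intro k
    exact (measurableSet_le (f := fun _ : Ef n × Ef n => 1 / ((k:ℝ) + 1)) (g := fun p => p.1.2)
      measurable_const (by fun_prop)).inter (measurableSet_le (f := fun p : Ef n × Ef n => ‖p.2‖)
      (g := fun _ => (k:ℝ)) (by fun_prop) measurable_const)
  · have h0 : ∀ᵐ t : ℝ, t ≠ 0 := by simp [ae_iff]
    have h1 : ∀ᵐ y : Ef n, y.2 ≠ 0 :=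
      (Measure.quasiMeasurePreserving_snd (μ := (volume : Measure (Eb n))) (ν := (volume : Measure ℝ))).ae h0
    have h2 : ∀ᵐ y ∂(muPlus n), 0 < y.2 := by
      filter_upwards [ae_restrict_of_ae h1, ae_restrict_mem (halfMeas n)] with y h1 h2
      exact lt_of_le_of_ne h2 h1.symm
    have h3 : ∀ᵐ p ∂(muT n), 0 < p.1.2 := (Measure.quasiMeasurePreserving_fst (μ := muPlus n)
      (ν := (volume : Measure (Ef n)))).ae h2
    filter_upwards [h3] with p hp
    have h4 : ∀ᶠ k : ℕ in atTop, 1 / ((k:ℝ) + 1) < p.1.2 :=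
      (tendsto_order.1 (tendsto_one_div_add_atTop_nhds_zero_nat (𝕜 := ℝ))).2 _ hp
    have h5 : ∀ᶠ k : ℕ in atTop, ‖p.2‖ ≤ k := tendsto_natCast_atTop_atTop.eventually_ge_atTop _
    filter_upwards [h4, h5] with k h4 h5 using ⟨h4.le, h5⟩
  · intro k ξ hm hL hξ
    have hb := bridgeP hP hL.coeFn_toLp
    suffices hh : eLpNorm (FOp (qP f) ξ) 2 (muT n) ≤ ENNReal.ofReal a * eLpNorm ξ 2 (muT n) by
      rw [← eLpNorm_congr_ae hb, ← Lp.enorm_def, ← Lp.enorm_toLp hL, ← ofReal_norm, ← ofReal_norm,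
        ← ENNReal.ofReal_mul ha] at hh
      exact (ENNReal.ofReal_le_ofReal_iff (by positivity)).1 hh
    refine lim_le (V := volume (Metric.closedBall (0 : Ef n) C)) measure_closedBall_lt_top.ne hL.2.ne
      fun ε hε => ?_
    obtain ⟨δ, hδ, H⟩ := h.closeP k hε
    have hev : ∀ᶠ s in 𝓝[>] (0:ℝ), s < δ ∧ s < 1 / (((k:ℝ) + 1) * (2 * C + k)) ∧ 0 < s := by
      refine (eventually_nhdsWithin_of_eventually_nhds (eventually_lt_nhds hδ)).and
        ((eventually_nhdsWithin_of_eventually_nhds (eventually_lt_nhds (by positivity))).and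
        self_mem_nhdsWithin)
    obtain ⟨s, hb, hs1, hs2, hs⟩ := (hfr.and_eventually hev).exists
    refine lower (β := fun y => y) hs (h.regA s) h.regP measurable_id hb hm hL ?_
    intro y v w hw hne
    have hS : 1 / ((k:ℝ) + 1) ≤ y.2 ∧ ‖v - w‖ ≤ k := by
      by_contra hcon
      exact hne (hξ _ hcon)
    have hu : |(v - w).2| ≤ k := (le_max_right ‖(v - w).1‖ ‖(v - w).2‖ : _ ≤ ‖v - w‖).trans hS.2
    have := H s hs hs1 y (v - w) w hw hS.2 (by
      have h1 := (abs_le.1 hu).1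
      have h2 : 2 * C + k ≤ y.2 / s := by
        rw [le_div_iff₀ hs]
        rw [lt_div_iff₀ (by positivity)] at hs2
        refine le_trans ?_ hS.1
        rw [le_div_iff₀ (by positivity)]
        linarith
      linarith)
    rwa [sub_add_cancel] at this

lemma FK.lowerB (h : FK f K M C) {B : HB n →L[ℂ] HB n} (hB : piBSpec n f K B) {a : ℝ} (ha : 0 ≤ a)
    (hfr : ∃ᶠ s in 𝓝[>] (0:ℝ), OpBound (kA f K s) s (ENNReal.ofReal a)) : ‖B‖ ≤ a := by
  have hC := h.C0
  refine dense_bound ha (fun k : ℕ => {p : Eb n × Ef n | 0 ≤ p.2.2 ∧ ‖p.2‖ ≤ k}) ?_ ?_ ?_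
  · intro k
    exact (halfMeasB n).inter (measurableSet_le (f := fun p : Eb n × Ef n => ‖p.2‖)
      (g := fun _ => (k:ℝ)) (by fun_prop) measurable_const)
  · have h4 : ∀ᵐ q ∂(muB n), 0 ≤ q.2.2 := ae_restrict_mem (halfMeasB n)
    filter_upwards [h4] with p hp
    have h5 : ∀ᶠ k : ℕ in atTop, ‖p.2‖ ≤ k := tendsto_natCast_atTop_atTop.eventually_ge_atTop _
    filter_upwards [h5] with k h5 using ⟨hp, h5⟩
  · intro k ξ hm hL hξ
    have hoff : ∀ x : Eb n × Ef n, ¬ 0 ≤ x.2.2 → ξ x = 0 := fun x hx => hξ x fun hh => hx hh.1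
    have hL' : MemLp ξ 2 ((volume : Measure (Eb n)).prod (volume : Measure (Ef n))) := by
      refine ⟨hm.aestronglyMeasurable, ?_⟩
      rw [← eLpB_off hoff]; exact hL.2
    have hb := h.bridgeB hB hm hL' hL.coeFn_toLp
    suffices hh : eLpNorm (FOp (qB f K) ξ) 2 ((volume : Measure (Eb n)).prod (volume : Measure (Ef n)))
        ≤ ENNReal.ofReal a * eLpNorm ξ 2 ((volume : Measure (Eb n)).prod (volume : Measure (Ef n))) by
      rw [← eLpB_off hoff, ← eLpB_off (fun x hx => FOp_off hx),
        ← eLpNorm_congr_ae hb, ← Lp.enorm_def, ← Lp.enorm_toLp hL, ← ofReal_norm, ← ofReal_norm,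
        ← ENNReal.ofReal_mul ha] at hh
      exact (ENNReal.ofReal_le_ofReal_iff (by positivity)).1 hh
    refine lim_le (V := volume (Metric.closedBall (0 : Ef n) C)) measure_closedBall_lt_top.ne hL'.2.ne
      fun ε hε => ?_
    obtain ⟨δ, hδ, H⟩ := h.closeB k hε
    have hev : ∀ᶠ s in 𝓝[>] (0:ℝ), s < δ ∧ 0 < s :=
      (eventually_nhdsWithin_of_eventually_nhds (eventually_lt_nhds hδ)).and self_mem_nhdsWithin
    obtain ⟨s, hb, hs1, hs⟩ := (hfr.and_eventually hev).exists
    refine lower (β := fun y : Eb n => ((y, 0) : Ef n)) hs (h.regA s) h.regB (by fun_prop) hb hm hL' ?_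
    intro y v w hw hne
    have hS : 0 ≤ (v - w).2 ∧ ‖v - w‖ ≤ k := by
      by_contra hcon
      exact hne (hξ _ hcon)
    have h1 : ‖(v - w).1‖ ≤ k := (le_max_left ‖(v - w).1‖ ‖(v - w).2‖ : _ ≤ ‖v - w‖).trans hS.2
    have hu : |(v - w).2| ≤ k := (le_max_right ‖(v - w).1‖ ‖(v - w).2‖ : _ ≤ ‖v - w‖).trans hS.2
    have := H s hs hs1 y (v - w) w hw h1 ((le_abs_self _).trans hu)
    rwa [sub_add_cancel] at this
end

section
variable {n : ℕ} {f : Ef n × Ef n → ℂ} {K : Eb n × Eb n × ℝ × ℝ → ℂ} {M C : ℝ}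

lemma exists_eps {V : ENNReal} (hV : V ≠ ⊤) (M : ℝ) {e : ℝ} (he : 0 < e) : ∃ ε > 0,
    V ^ 2 * (2 * ENNReal.ofReal ε ^ 2 + 2 * ENNReal.ofReal M ^ 2 *
      (2 * ENNReal.ofReal ε + 2 * ENNReal.ofReal ε ^ 2)) ≤ ENNReal.ofReal e ^ 2 := by
  have ht : Tendsto (fun ε : ℝ => V ^ 2 * (2 * ENNReal.ofReal ε ^ 2 + 2 * ENNReal.ofReal M ^ 2 *
      (2 * ENNReal.ofReal ε + 2 * ENNReal.ofReal ε ^ 2))) (𝓝[>] 0)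
      (𝓝 (V ^ 2 * (2 * 0 ^ 2 + 2 * ENNReal.ofReal M ^ 2 * (2 * 0 + 2 * 0 ^ 2)))) := by
    have h0 : Tendsto (fun ε : ℝ => ENNReal.ofReal ε) (𝓝[>] 0) (𝓝 0) := by
      have := (ENNReal.continuous_ofReal.tendsto 0).mono_left
        (nhdsWithin_le_nhds : 𝓝[>] (0:ℝ) ≤ 𝓝 0)
      simpa using this
    have h1 : Tendsto (fun ε : ℝ => 2 * ENNReal.ofReal ε) (𝓝[>] 0) (𝓝 (2 * 0)) :=
      ENNReal.Tendsto.const_mul h0 (Or.inr (by simp))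
    have h2 : Tendsto (fun ε : ℝ => 2 * ENNReal.ofReal ε ^ 2) (𝓝[>] 0) (𝓝 (2 * 0 ^ 2)) :=
      ENNReal.Tendsto.const_mul (ENNReal.Tendsto.pow h0) (Or.inr (by simp))
    refine ENNReal.Tendsto.const_mul (h2.add ?_) (Or.inr (ENNReal.pow_ne_top hV))
    exact ENNReal.Tendsto.const_mul (h1.add h2)
      (Or.inr (ENNReal.mul_ne_top (by simp) (ENNReal.pow_ne_top (by simp))))
  simp only [ne_eq, OfNat.ofNat_ne_zero, not_false_eq_true, zero_pow, mul_zero, add_zero] at ht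
  have hpos : (0 : ENNReal) < ENNReal.ofReal e ^ 2 := by
    have : 0 < ENNReal.ofReal e := by simpa using he
    positivity
  obtain ⟨ε, h1, h2⟩ := ((ht.eventually (gt_mem_nhds hpos)).and self_mem_nhdsWithin).exists
  exact ⟨ε, h2, h1.le⟩

lemma enorm_of_abs {a b : ℝ} (h : |a| ≤ b) : ‖a‖ₑ ≤ ENNReal.ofReal b := by
  rw [← ofReal_norm]; exact ENNReal.ofReal_le_ofReal h

/-- pointwise bound for increments of a product -/
lemma prod_incr {a a' c c' ε : ℝ} (hc : |c'| ≤ 1) (hcc : |c' - c| ≤ ε) :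
    ‖a' * c' - a * c‖ₑ ^ 2 ≤ 2 * ‖a' - a‖ₑ ^ 2 + 2 * ENNReal.ofReal ε ^ 2 * ‖a‖ₑ ^ 2 := by
  have e : a' * c' - a * c = (a' - a) * c' + a * (c' - c) := by ring
  rw [e]
  calc _ ≤ (‖(a' - a) * c'‖ₑ + ‖a * (c' - c)‖ₑ) ^ 2 := by gcongr; exact enorm_add_le _ _
    _ ≤ 2 * ‖(a' - a) * c'‖ₑ ^ 2 + 2 * ‖a * (c' - c)‖ₑ ^ 2 := sq_add_le _ _
    _ ≤ 2 * ‖a' - a‖ₑ ^ 2 + 2 * (ENNReal.ofReal ε ^ 2 * ‖a‖ₑ ^ 2) := by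
      rw [enorm_mul, enorm_mul]
      have h1 : ‖c'‖ₑ ≤ 1 := by simpa using enorm_of_abs hc
      have h2 := enorm_of_abs hcc
      gcongr
      · exact (mul_le_mul_right h1 _).trans (by simp)
      · rw [← mul_pow, mul_comm]; gcongr
    _ = _ := by rw [mul_assoc]

lemma int_incr {E : Type*} [MeasurableSpace E] {μ : Measure E} {φ ψ : E → ℝ} (h1 : Measurable φ)
    (h2 : Measurable ψ) {a b : ENNReal} (ha : ∫⁻ v, ‖ψ v - φ v‖ₑ ^ 2 ∂μ ≤ a)
    (hb : ∫⁻ v, ‖φ v‖ₑ ^ 2 ∂μ = 1) :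
    ∫⁻ v, (2 * ‖ψ v - φ v‖ₑ ^ 2 + 2 * b * ‖φ v‖ₑ ^ 2) ∂μ ≤ 2 * a + 2 * b := by
  rw [lintegral_add_left (by fun_prop), lintegral_const_mul _ (by fun_prop),
    lintegral_const_mul _ (by fun_prop), hb, mul_one]
  gcongr

lemma P_swap {α : Ef n → ENNReal} (hα : Measurable α) {F : Ef n → ENNReal} (hF : Measurable F) (s : ℝ) :
    ∫⁻ p, α p.2 * F (p.1 + s • p.2) ∂((muPlus n).prod volume) =
      ∫⁻ v, α v * ∫⁻ y, F (y + s • v) ∂(muPlus n) := by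
  rw [lintegral_prod_symm _ (by fun_prop)]
  congr 1; ext v
  simp only
  rw [lintegral_const_mul _ (by fun_prop)]

lemma P_le {α : Ef n → ENNReal} (hα : Measurable α) {F : Ef n → ENNReal} (hF : Measurable F) (s : ℝ) :
    ∫⁻ p, α p.2 * F (p.1 + s • p.2) ∂((muPlus n).prod volume) ≤ (∫⁻ v, α v) * ∫⁻ x, F x := by
  rw [P_swap hα hF, ← lintegral_mul_const _ hα]
  refine lintegral_mono fun v => mul_le_mul_right ?_ _
  calc _ ≤ ∫⁻ y, F (y + s • v) := lintegral_mono' Measure.restrict_le_self le_rfl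
    _ = _ := lintegral_add_right_eq_self F _

lemma P_eq {α : Ef n → ENNReal} (hα : Measurable α) {F : Ef n → ENNReal} (hF : Measurable F) {s : ℝ}
    (h : ∀ y v : Ef n, α v ≠ 0 → y.2 < 0 → F (y + s • v) = 0) :
    ∫⁻ p, α p.2 * F (p.1 + s • p.2) ∂((muPlus n).prod volume) = (∫⁻ v, α v) * ∫⁻ x, F x := by
  rw [P_swap hα hF, ← lintegral_mul_const _ hα]
  congr 1; ext v
  by_cases h0 : α v = 0
  · simp [h0]
  congr 1
  rw [← lintegral_add_right_eq_self F (s • v), muPlus, ← lintegral_indicator (halfMeas n)]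
  congr 1; ext y
  by_cases hy : 0 ≤ y.2
  · rw [indicator_of_mem (by exact hy)]
  · rw [indicator_of_notMem (by exact hy), h y v h0 (not_le.1 hy)]

lemma B_eq {α : Eb n → ENNReal} (hα : Measurable α) {γ : ℝ → ENNReal} (hγ : Measurable γ)
    {F : Ef n → ENNReal} (hF : Measurable F) {s : ℝ} (hs : 0 < s) :
    ∫⁻ p, α p.2.1 * γ p.2.2 * F ((p.1, 0) + s • p.2)
      ∂((volume : Measure (Eb n)).prod (volume : Measure (Ef n))) =
    (∫⁻ v, α v) * (ENNReal.ofReal s⁻¹ * ∫⁻ x : Ef n, γ (x.2 / s) * F x) := by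
  rw [lintegral_prod_symm _ (by fun_prop)]
  set G : ℝ → ENNReal := fun t => ∫⁻ y : Eb n, F (y, t) with hG
  have hGm : Measurable G := Measurable.lintegral_prod_left' (f := fun p : Eb n × ℝ => F p) hF
  have e1 : ∀ v : Ef n, ∫⁻ y : Eb n, α v.1 * γ v.2 * F ((y, 0) + s • v) =
      α v.1 * (γ v.2 * G (s * v.2)) := by
    intro v
    rw [lintegral_const_mul _ (by fun_prop), mul_assoc]
    congr 2
    rw [hG]
    simp only
    rw [← lintegral_add_right_eq_self (fun y : Eb n => F (y, s * v.2)) (s • v.1)]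
    congr 1; ext y
    congr 1
    ext1 <;> simp
  simp only [e1]
  have e2 := lintegral_prod_mul (μ := (volume : Measure (Eb n))) (ν := (volume : Measure ℝ))
    (f := α) (g := fun t => γ t * G (s * t)) (by fun_prop) (by fun_prop)
  refine Eq.trans e2 ?_
  congr 1
  have e3 := scal (fun t : ℝ => γ (t / s) * G t) (by fun_prop) 0 hs
  simp only [zero_add, smul_eq_mul, Module.finrank_self, pow_one] at e3
  have e4 : ∫⁻ x : Ef n, γ (x.2 / s) * F x = ∫⁻ t : ℝ, γ (t / s) * G t := by
    have := lintegral_prod_symm (μ := (volume : Measure (Eb n))) (ν := (volume : Measure ℝ))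
      (fun x : Ef n => γ (x.2 / s) * F x) (by fun_prop)
    refine Eq.trans this ?_
    congr 1; ext t
    simp only
    rw [lintegral_const_mul _ (by fun_prop)]
  rw [e4, ← e3]
  congr 1; ext t
  rw [mul_div_cancel_left₀ _ hs.ne']

lemma abs_le_one_of {a b : ℝ} (h : a ^ 2 + b ^ 2 = 1) : |a| ≤ 1 ∧ |b| ≤ 1 := by
  constructor <;> rw [← sq_le_one_iff_abs_le_one] <;> nlinarith [sq_nonneg a, sq_nonneg b]

lemma FK.upperAll (h : FK f K M C) {P : HT n →L[ℂ] HT n} (hP : pi0Spec n f P)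
    {B : HB n →L[ℂ] HB n} (hB : piBSpec n f K B) {e : ℝ} (he : 0 < e) :
    ∀ᶠ s in 𝓝[>] (0:ℝ), OpBound (kA f K s) s
      (ENNReal.ofReal (max ‖P‖ ‖B‖) + 2 * ENNReal.ofReal e) := by
  have hC := h.C0
  obtain ⟨ε, hε, hεe⟩ := exists_eps (V := volume (Metric.closedBall (0 : Ef n) C))
    measure_closedBall_lt_top.ne M he
  obtain ⟨R, A, φ, hR, hφm, hφA, hφs, hφ1, hφw⟩ := exists_window (E := Ef n) C hε
  obtain ⟨R', A', ψ, hR', hψm, hψA, hψs, hψ1, hψw⟩ := exists_window (E := Eb n) C hε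
  obtain ⟨R2, χ0, χ1, c0, c1, hsum, hz1, hz0, hd0, hd1⟩ := exists_cut (max R (2 * C)) C hε
  have m0 := c0.measurable
  have m1 := c1.measurable
  obtain ⟨δ, hδ, HP⟩ := h.closeP R hε
  obtain ⟨δ', hδ', HB⟩ := h.closeB (max R' R2) hε
  have hev : ∀ᶠ s in 𝓝[>] (0:ℝ), s < δ ∧ s < δ' ∧ 0 < s := by
    refine (eventually_nhdsWithin_of_eventually_nhds (eventually_lt_nhds hδ)).and
      ((eventually_nhdsWithin_of_eventually_nhds (eventually_lt_nhds hδ')).and self_mem_nhdsWithin)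
  filter_upwards [hev] with s ⟨hs1, hs2, hs⟩
  have ab0 : ∀ t, |χ0 t| ≤ 1 := fun t => (abs_le_one_of (hsum t)).1
  have ab1 : ∀ t, |χ1 t| ≤ 1 := fun t => (abs_le_one_of (hsum t)).2
  have hw2 : ∀ w : Ef n, ‖w‖ ≤ C → |w.2| ≤ C := fun w hw =>
    (le_max_right ‖w.1‖ ‖w.2‖ : |w.2| ≤ ‖w‖).trans hw
  have hw1 : ∀ w : Ef n, ‖w‖ ≤ C → ‖w.1‖ ≤ C := fun w hw =>
    (le_max_left ‖w.1‖ ‖w.2‖ : ‖w.1‖ ≤ ‖w‖).trans hw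
  have hdiv : ∀ y v : Ef n, (y + s • v).2 / s = y.2 / s + v.2 := by
    intro y v
    simp only [Prod.snd_add, Prod.smul_snd, smul_eq_mul]; field_simp
  refine combine (χ0 := fun x : Ef n => χ0 (x.2 / s)) (χ1 := fun x : Ef n => χ1 (x.2 / s))
    (h.regA s) (by fun_prop) (by fun_prop) (fun x => hsum _) ?_ ?_
  · intro ξ hm hL
    have hB' : ‖B‖ₑ ≤ ENNReal.ofReal (max ‖P‖ ‖B‖) := by
      rw [← ofReal_norm]; exact ENNReal.ofReal_le_ofReal (le_max_right _ _)
    have hj : ENNReal.ofReal (√ s⁻¹) ^ 2 = ENNReal.ofReal s⁻¹ := by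
      rw [← ENNReal.ofReal_pow (by positivity), Real.sq_sqrt (by positivity)]
    refine le_trans (upper (ν := (volume : Measure (Eb n))) (q := qB f K)
      (β := fun y : Eb n => ((y, 0) : Ef n))
      (Φ := fun p : Eb n × Ef n => ψ p.2.1 * χ0 p.2.2) (A := A' * 1)
      (χ := fun x : Ef n => χ0 (x.2 / s)) (j := ENNReal.ofReal (√ s⁻¹))
      (δ := 2 * ENNReal.ofReal ε + 2 * ENNReal.ofReal ε ^ 2) (ε := ε) hs (h.regA s) h.regB
      (by fun_prop) (h.boundB hB) (by fun_prop) ?_ (by fun_prop) (fun x => ab0 _)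
      ?_ ENNReal.ofReal_ne_top ?_ ?_ ?_ hεe hm hL) (by gcongr)
    · intro p
      rw [norm_mul]
      exact mul_le_mul (hψA _) (ab0 _) (norm_nonneg _) ((norm_nonneg _).trans (hψA 0))
    · simp only [ne_eq, ENNReal.ofReal_eq_zero, not_le]; positivity
    · intro g hg
      rw [hj, ← one_mul (ENNReal.ofReal s⁻¹ * _), ← hψ1,
        ← B_eq (α := fun v => ‖ψ v‖ₑ ^ 2) (γ := fun t => ‖χ0 t‖ₑ ^ 2) (by fun_prop) (by fun_prop) hg hs]
      simp only [enorm_mul, mul_pow]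
    · intro w hw g hg
      rw [hj]
      have hαm : Measurable (fun v => 2 * ‖ψ (v + w.1) - ψ v‖ₑ ^ 2 +
        2 * ENNReal.ofReal ε ^ 2 * ‖ψ v‖ₑ ^ 2) := by fun_prop
      have b1 := B_eq hαm (γ := fun _ => 1) measurable_const hg hs
      have b2 := int_incr hψm (hψm.comp (measurable_add_const w.1)) (b := ENNReal.ofReal ε ^ 2)
        (hψw w.1 (hw1 w hw)) hψ1
      refine le_trans (lintegral_mono fun p => ?_) (b1.le.trans ?_)
      · rw [mul_one]
        gcongr
        exact prod_incr (ab0 _) (hd0 _ _ (hw2 w hw))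
      · simp only [one_mul]
        rw [mul_left_comm]
        gcongr
        exact b2
    · intro y u w hw hne
      have h1 : ‖u.1‖ ≤ R' := by
        by_contra hc; exact hne (by simp [hψs _ (not_le.1 hc)])
      have h2 : u.2 ≤ R2 := by
        by_contra hc; exact hne (by simp [hz0 _ (not_le.1 hc).le])
      exact HB s hs hs2 y u w hw (h1.trans (le_max_left _ _)) (h2.trans (le_max_right _ _))
  · intro ξ hm hL
    have hP' : ‖P‖ₑ ≤ ENNReal.ofReal (max ‖P‖ ‖B‖) := by
      rw [← ofReal_norm]; exact ENNReal.ofReal_le_ofReal (le_max_left _ _)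
    refine le_trans (upper (ν := muPlus n) (q := qP f)
      (β := fun y : Ef n => y)
      (Φ := fun p : Ef n × Ef n => φ p.2 * χ1 (p.1.2 / s + p.2.2)) (A := A * 1)
      (χ := fun x : Ef n => χ1 (x.2 / s)) (j := 1)
      (δ := 2 * ENNReal.ofReal ε + 2 * ENNReal.ofReal ε ^ 2) (ε := ε) hs (h.regA s) h.regP
      measurable_id (boundP hP) (by fun_prop) ?_ (by fun_prop) (fun x => ab1 _)
      one_ne_zero ENNReal.one_ne_top ?_ ?_ ?_ hεe hm hL) (by gcongr)
    · intro p
      rw [norm_mul]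
      exact mul_le_mul (hφA _) (ab1 _) (norm_nonneg _) ((norm_nonneg _).trans (hφA 0))
    · intro g hg
      rw [one_pow, ← hφ1, ← P_eq (α := fun v => ‖φ v‖ₑ ^ 2)
        (F := fun x : Ef n => ‖χ1 (x.2 / s)‖ₑ ^ 2 * g x) (s := s) (by fun_prop) (by fun_prop)]
      · simp only [enorm_mul, mul_pow, hdiv, mul_assoc]
      · intro y v hv hy
        have h1 : ‖v‖ ≤ R := by
          by_contra hc; exact hv (by simp [hφs _ (not_le.1 hc)])
        have h2 : v.2 ≤ R := ((le_abs_self _).trans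
          (le_max_right ‖v.1‖ ‖v.2‖ : |v.2| ≤ ‖v‖)).trans h1
        have h3 : y.2 / s < 0 := div_neg_of_neg_of_pos hy hs
        have h4 := le_max_left R (2 * C)
        rw [hdiv, hz1 _ (by linarith)]
        simp
    · intro w hw g hg
      rw [one_pow, one_mul]
      have hαm : Measurable (fun v => 2 * ‖φ (v + w) - φ v‖ₑ ^ 2 +
        2 * ENNReal.ofReal ε ^ 2 * ‖φ v‖ₑ ^ 2) := by fun_prop
      have b1 := P_le hαm hg s
      have b2 := int_incr hφm (hφm.comp (measurable_add_const w)) (b := ENNReal.ofReal ε ^ 2)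
        (hφw w hw) hφ1
      refine le_trans (lintegral_mono fun p => ?_) (b1.trans ?_)
      · gcongr
        refine prod_incr (ab1 _) ?_
        have := hd1 (p.1.2 / s + p.2.2) w.2 (hw2 w hw)
        simpa [add_assoc] using this
      · gcongr
        exact b2
    · intro y u w hw hne
      have h1 : ‖u‖ ≤ R := by
        by_contra hc; exact hne (by simp [hφs _ (not_le.1 hc)])
      have h2 : 2 * C ≤ y.2 / s + u.2 := by
        by_contra hc
        exact hne (by simp [hz1 _ ((not_le.1 hc).le.trans (le_max_right R (2 * C)))])
      exact HP s hs hs1 y u w hw h1 h2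
end

/-- For every `f ∈ C_c^∞(ℝⁿ×ℝⁿ)` and every smooth compactly supported `K` on
`ℝ^{n−1}×ℝ^{n−1}×ℝ₊×ℝ₊`, the limit `lim_{ℏ→0⁺} ‖ρ_ℏ(f)+κ_ℏ(K)‖` exists and equals
`max{‖π₀(f)‖, ‖π₀^∂(f⊕K)‖}`. -/
theorem statement11 (n : ℕ) (hn : 1 ≤ n) (f : Ef n × Ef n → ℂ)
    (hf : ContDiff ℝ ∞ f) (hf' : HasCompactSupport f)
    (K : Eb n × Eb n × ℝ × ℝ → ℂ)
    (hK : ContDiff ℝ ∞ K) (hK' : HasCompactSupport K)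
    (T S : ℝ → (HS n →L[ℂ] HS n))
    (hT : ∀ ℏ ∈ Ioc (0:ℝ) 1, rhoSpec n ℏ f (T ℏ))
    (hS : ∀ ℏ ∈ Ioc (0:ℝ) 1, kappaSpec n ℏ K (S ℏ))
    (P : HT n →L[ℂ] HT n) (hP : pi0Spec n f P)
    (B : HB n →L[ℂ] HB n) (hB : piBSpec n f K B) :
    Tendsto (fun ℏ => ‖T ℏ + S ℏ‖) (𝓝[>] (0:ℝ)) (𝓝 (max ‖P‖ ‖B‖)) := by
  obtain ⟨M, C, h⟩ := exists_FK hf.continuous hf' hK.continuous hK'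
  have h01 : ∀ᶠ s in 𝓝[>] (0:ℝ), s ∈ Ioc (0:ℝ) 1 := Ioc_mem_nhdsGT one_pos
  have hm : 0 ≤ max ‖P‖ ‖B‖ := (norm_nonneg P).trans (le_max_left _ _)
  rw [tendsto_order]
  constructor
  · intro a ha
    by_contra hcon
    rw [not_eventually] at hcon
    have hex := hcon.and_eventually h01
    have ha0 : 0 ≤ a := by
      obtain ⟨s, hs, -⟩ := hex.exists
      exact (norm_nonneg _).trans (not_lt.1 hs)
    have hfr : ∃ᶠ s in 𝓝[>] (0:ℝ), OpBound (kA f K s) s (ENNReal.ofReal a) := by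
      refine hex.mono fun s hs => ?_
      intro ξ hm hL
      refine (h.boundA hs.2.1 (hT s hs.2) (hS s hs.2) ξ hm hL).trans ?_
      gcongr
      rw [← ofReal_norm]
      exact ENNReal.ofReal_le_ofReal (not_lt.1 hs.1)
    exact absurd ha (not_lt.2 (max_le (h.lowerP hP ha0 hfr) (h.lowerB hB ha0 hfr)))
  · intro a ha
    set e := (a - max ‖P‖ ‖B‖) / 4 with he
    have he0 : 0 < e := by rw [he]; linarith
    filter_upwards [h01, h.upperAll hP hB he0] with s hs hb
    have : ENNReal.ofReal (max ‖P‖ ‖B‖) + 2 * ENNReal.ofReal e =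
        ENNReal.ofReal (max ‖P‖ ‖B‖ + 2 * e) := by
      rw [ENNReal.ofReal_add hm (by positivity), ENNReal.ofReal_mul (by norm_num)]
      simp
    rw [this] at hb
    have := h.boundA' hs.1 (hT s hs) (hS s hs) (by positivity) hb
    linarith
end
end
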